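/- arXiv:2403.18075 — 8 statements merged into one kernel-verified Lean document; each statement's English description precedes it below -/
import Mathlib

section
/- There exists N such that for every prime p > N, T_p(1,1,1) = (3/16)·(B_{p−3}/3) and S_p(1,1,1) = −(3/16)·(B_{p−3}/3) in ℤ/pℤ; that is, T_𝒜(1,1,1) = −S_𝒜(1,1,1) = (3/16)β_3. -/
open scoped Classical

/-- Finite multiple T-sum `T_p(s₁,…,s_d)`: the sum over
`p > n₁ > ⋯ > n_d > 0` with `n_j ≡ d−j+1 (mod 2)` of `∏ n_j^{−s_j}` in `ℤ/pℤ`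
(indices written 0-based, so the parity condition reads `n_j ≡ d−j (mod 2)`). -/
noncomputable def TsumP (p : ℕ) (s : List ℕ) : ZMod p :=
  ∑ n : Fin s.length → Fin p,
    if (∀ j, 0 < (n j : ℕ)) ∧ (∀ i j : Fin s.length, i < j → (n j : ℕ) < (n i : ℕ)) ∧
       (∀ j : Fin s.length, (n j : ℕ) % 2 = (s.length - (j : ℕ)) % 2)
    then ∏ j, (((n j : ℕ) : ZMod p) ^ s.get j)⁻¹
    else 0

/-- Finite multiple S-sum `S_p(s₁,…,s_d)`: as `T_p` but with the parity
condition `n_j ≡ d−j (mod 2)` (1-based), i.e. `n_j ≡ d−1−j (mod 2)` 0-based. -/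
noncomputable def SsumP (p : ℕ) (s : List ℕ) : ZMod p :=
  ∑ n : Fin s.length → Fin p,
    if (∀ j, 0 < (n j : ℕ)) ∧ (∀ i j : Fin s.length, i < j → (n j : ℕ) < (n i : ℕ)) ∧
       (∀ j : Fin s.length, (n j : ℕ) % 2 = (s.length - 1 - (j : ℕ)) % 2)
    then ∏ j, (((n j : ℕ) : ZMod p) ^ s.get j)⁻¹
    else 0

/-- Reduction of a rational number mod `p` (numerator over denominator). -/
noncomputable def rQ (p : ℕ) (x : ℚ) : ZMod p := (x.num : ZMod p) * ((x.den : ℕ) : ZMod p)⁻¹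

/-- The partial sum `f 0 + ⋯ + f (n - 1)`. -/
def prefixSum {K : Type*} [AddCommMonoid K] (f : ℕ → K) (n : ℕ) : K := ∑ i ∈ Finset.range n, f i

/-- The inverse of `n` modulo `p` for odd `n`, and `0` for even `n`. -/
def oddInv (p n : ℕ) : ZMod p := if Odd n then (n : ZMod p)⁻¹ else 0

/-- The inverse of `n` modulo `p` for even `n`, and `0` for odd `n`. -/
def evenInv (p n : ℕ) : ZMod p := if Even n then (n : ZMod p)⁻¹ else 0

section PrefixSum

variable {K : Type*} [CommRing K]

lemma prefixSum_succ (f : ℕ → K) (n : ℕ) : prefixSum f (n + 1) = prefixSum f n + f n :=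
  Finset.sum_range_succ f n

lemma prefixSum_zero (f : ℕ → K) : prefixSum f 0 = 0 := Finset.sum_range_zero f

lemma prefixSum_congr {f g : ℕ → K} {n : ℕ} (h : ∀ i < n, f i = g i) :
    prefixSum f n = prefixSum g n :=
  Finset.sum_congr rfl fun i hi => h i (Finset.mem_range.1 hi)

lemma prefixSum_add (f g : ℕ → K) (n : ℕ) :
    prefixSum (fun i => f i + g i) n = prefixSum f n + prefixSum g n :=
  Finset.sum_add_distrib

lemma prefixSum_neg (f : ℕ → K) (n : ℕ) :
    prefixSum (fun i => -f i) n = -prefixSum f n :=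
  Finset.sum_neg_distrib f

lemma prefixSum_sub (f g : ℕ → K) (n : ℕ) :
    prefixSum (fun i => f i - g i) n = prefixSum f n - prefixSum g n :=
  Finset.sum_sub_distrib f g

lemma prefixSum_mul_left (c : K) (f : ℕ → K) (n : ℕ) :
    prefixSum (fun i => c * f i) n = c * prefixSum f n :=
  (Finset.mul_sum _ _ _).symm

/-- The quasi-shuffle product of two partial sums. -/
lemma prefixSum_mul_prefixSum (f g : ℕ → K) (n : ℕ) :
    prefixSum f n * prefixSum g n =
      prefixSum (fun a => f a * prefixSum g a) n + prefixSum (fun a => g a * prefixSum f a) n +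
        prefixSum (fun a => f a * g a) n := by
  induction n with
  | zero => simp [prefixSum_zero]
  | succ n ih => simp only [prefixSum_succ]; linear_combination ih

/-- Summing a convolution over all `i + j < n`. -/
lemma prefixSum_convolution (f g : ℕ → K) (n : ℕ) :
    prefixSum (fun b => ∑ j ∈ Finset.range (b + 1), f j * g (b - j)) n =
      prefixSum (fun j => f j * prefixSum g (n - j)) n := by
  simp only [prefixSum, Finset.mul_sum]
  exact Finset.sum_range_diag_flip n fun m k => f m * g k

/-- The part of a sum beyond `n`, read backwards. -/
lemma prefixSum_sub_reflect {f g : ℕ → K} {p : ℕ} (h : ∀ n ≤ p, f (p - n) = g n) (hp : g p = 0)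
    {n : ℕ} (hn : n ≤ p) : prefixSum f (p - n) = prefixSum g p - prefixSum g (n + 1) := by
  obtain ⟨m, rfl⟩ := Nat.exists_eq_add_of_le hn
  rw [Nat.add_sub_cancel_left]
  induction m generalizing n with
  | zero => simp [prefixSum_zero, prefixSum_succ] at *; exact hp
  | succ m ih =>
    have e : n + (m + 1) = (n + 1) + m := by ring
    rw [e] at h hp
    have h1 := ih h hp (by omega)
    have h2 := h (n + 1) (by omega)
    rw [Nat.add_sub_cancel_left] at h2
    rw [e, prefixSum_succ, h1, h2, prefixSum_succ g (n + 1)]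
    ring

/-- Reversal of a sum over `0 < n < p`. -/
lemma prefixSum_reflect {f g : ℕ → K} {p : ℕ} (h : ∀ n ≤ p, f (p - n) = g n) (h0 : g 0 = 0)
    (hp : g p = 0) : prefixSum f p = prefixSum g p := by
  have := prefixSum_sub_reflect h hp (Nat.zero_le p)
  simpa [prefixSum_succ, prefixSum_zero, h0] using this

/-- Splitting a sum over even numbers below `2p`, `p` odd, at `p`. -/
lemma prefixSum_two_mul {p : ℕ} (hp : Odd p) (g : ℕ → K) :
    prefixSum (fun a => g (2 * a)) p =
      prefixSum (fun x => if Even x then g x else 0) p +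
        prefixSum (fun x => if Odd x then g (x + p) else 0) p := by
  obtain ⟨m, rfl⟩ := hp
  have h1 : ∀ m, prefixSum (fun x => if Even x then g x else 0) (2 * m + 1) =
      prefixSum (fun a => g (2 * a)) (m + 1) := by
    intro m
    induction m with
    | zero => simp [prefixSum_succ, prefixSum_zero]
    | succ m ih =>
      rw [prefixSum_succ _ (m + 1), ← ih, show 2 * (m + 1) + 1 = 2 * m + 1 + 1 + 1 by ring,
        prefixSum_succ, prefixSum_succ, if_neg (by simp [parity_simps]),
        if_pos (by simp [parity_simps])]
      ring_nf
  have h2 : ∀ (f : ℕ → K) m, prefixSum (fun x => if Odd x then f x else 0) (2 * m + 1) =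
      prefixSum (fun a => f (2 * a + 1)) m := by
    intro f m
    induction m with
    | zero => simp [prefixSum_succ, prefixSum_zero]
    | succ m ih =>
      rw [prefixSum_succ _ m, ← ih, show 2 * (m + 1) + 1 = 2 * m + 1 + 1 + 1 by ring,
        prefixSum_succ, prefixSum_succ, if_pos (by simp [parity_simps]),
        if_neg (by simp [parity_simps])]
      ring_nf
  rw [h1, h2 fun x => g (x + (2 * m + 1))]
  simp only [prefixSum]
  rw [show 2 * m + 1 = (m + 1) + m by ring, Finset.sum_range_add]
  congr 1
  refine Finset.sum_congr rfl fun i _ => ?_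
  congr 1
  ring

end PrefixSum

section ParityInv

variable {p : ℕ} [Fact p.Prime]

lemma natCast_ne_zero_of_lt {n : ℕ} (h0 : 0 < n) (hn : n < p) : (n : ZMod p) ≠ 0 := by
  rw [Ne, ZMod.natCast_eq_zero_iff]
  exact Nat.not_dvd_of_pos_of_lt h0 hn

lemma oddInv_self : oddInv p p = 0 := by simp [oddInv]

lemma evenInv_self : evenInv p p = 0 := by simp [evenInv]

lemma oddInv_zero : oddInv p 0 = 0 := by simp [oddInv]

lemma evenInv_zero : evenInv p 0 = 0 := by simp [evenInv]

lemma evenInv_mul_oddInv (n : ℕ) : evenInv p n * oddInv p n = 0 := by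
  unfold evenInv oddInv
  rcases Nat.even_or_odd n with h | h
  · rw [if_neg (Nat.not_odd_iff_even.2 h), mul_zero]
  · rw [if_neg (Nat.not_even_iff_odd.2 h), zero_mul]

lemma oddInv_reflect (hp : Odd p) {n : ℕ} (hn : n ≤ p) : oddInv p (p - n) = -evenInv p n := by
  have : Odd (p - n) ↔ Even n := by
    rw [Nat.odd_sub hn]; simp [hp]
  simp only [oddInv, evenInv, this, Nat.cast_sub hn, CharP.cast_eq_zero, zero_sub, inv_neg]
  split_ifs <;> simp

lemma evenInv_reflect (hp : Odd p) {n : ℕ} (hn : n ≤ p) : evenInv p (p - n) = -oddInv p n := by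
  have : Even (p - n) ↔ Odd n := by
    rw [Nat.even_sub hn]; grind
  simp only [oddInv, evenInv, this, Nat.cast_sub hn, CharP.cast_eq_zero, zero_sub, inv_neg]
  split_ifs <;> simp

lemma oddInv_add_self (hp : Odd p) (n : ℕ) : oddInv p (n + p) = evenInv p n := by
  have : Odd (n + p) ↔ Even n := by
    rw [Nat.odd_add]; grind
  simp [oddInv, evenInv, this]

/-- Partial fractions for two odd indices. -/
lemma oddInv_mul_oddInv {i j : ℕ} (h : i + j < p) :
    oddInv p i * oddInv p j = evenInv p (i + j) * (oddInv p i + oddInv p j) := by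
  unfold evenInv oddInv
  by_cases hi : Odd i <;> by_cases hj : Odd j
  · have h1 := natCast_ne_zero_of_lt hi.pos (by omega : i < p)
    have h2 := natCast_ne_zero_of_lt hj.pos (by omega : j < p)
    have h3 := natCast_ne_zero_of_lt (by have := hi.pos; omega) h
    rw [if_pos hi, if_pos hj, if_pos (hi.add_odd hj)]
    push_cast at h3 ⊢
    field_simp
    ring
  all_goals grind

/-- Partial fractions for an even and an odd index. -/
lemma evenInv_mul_oddInv_of_pos {i j : ℕ} (hi0 : 0 < i) (h : i + j < p) :
    evenInv p i * oddInv p j = oddInv p (i + j) * (oddInv p j + evenInv p i) := by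
  unfold evenInv oddInv
  by_cases hi : Even i <;> by_cases hj : Odd j
  · have h1 := natCast_ne_zero_of_lt hi0 (by omega : i < p)
    have h2 := natCast_ne_zero_of_lt hj.pos (by omega : j < p)
    have h3 := natCast_ne_zero_of_lt (by omega) h
    rw [if_pos hi, if_pos hj, if_pos (hi.add_odd hj)]
    push_cast at h3 ⊢
    field_simp
  all_goals grind

/-- Convolution of two inverses of odd numbers. -/
lemma sum_oddInv_mul_oddInv {b : ℕ} (hb : b < p) :
    ∑ j ∈ Finset.range (b + 1), oddInv p j * oddInv p (b - j) =
      2 * (evenInv p b * prefixSum (oddInv p) b) := by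
  have h1 : ∀ j ∈ Finset.range (b + 1), oddInv p j * oddInv p (b - j) =
      evenInv p b * (oddInv p j + oddInv p (b - j)) := by
    intro j hj
    have hj' : j ≤ b := Nat.lt_succ_iff.1 (Finset.mem_range.1 hj)
    have := oddInv_mul_oddInv (p := p) (i := j) (j := b - j) (by omega)
    rwa [Nat.add_sub_cancel' hj'] at this
  rw [Finset.sum_congr rfl h1, ← Finset.mul_sum, Finset.sum_add_distrib,
    Finset.sum_flip (fun j => oddInv p j), ← prefixSum, prefixSum_succ]
  linear_combination 2 * evenInv_mul_oddInv (p := p) b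

end ParityInv

section Relations

variable {p : ℕ} [Fact p.Prime]

lemma prefixSum_evenInv_mul_oddInv (hp : Odd p) (h3 : (3 : ZMod p) ≠ 0) :
    prefixSum (fun a => evenInv p a * prefixSum (oddInv p) a) p = 0 := by
  have h := prefixSum_convolution (oddInv p) (oddInv p) p
  rw [prefixSum_congr fun b hb => sum_oddInv_mul_oddInv hb, prefixSum_mul_left,
    prefixSum_reflect (f := fun j => oddInv p j * _)
      (g := fun a => -(evenInv p a * prefixSum (oddInv p) a)) (fun n hn => by
      rw [oddInv_reflect hp hn, Nat.sub_sub_self hn, neg_mul]) (by simp [evenInv_zero])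
      (by simp [evenInv_self]), prefixSum_neg] at h
  refine (mul_eq_zero.1 ?_).resolve_left h3
  linear_combination h

lemma three_mul_prefixSum_oddInv_evenInv_oddInv (hp : Odd p) :
    3 * prefixSum (fun a => oddInv p a *
        prefixSum (fun b => evenInv p b * prefixSum (oddInv p) b) a) p =
      -prefixSum (fun a => evenInv p a *
        prefixSum (fun b => evenInv p b * prefixSum (oddInv p) b) a) p := by
  have h := prefixSum_convolution (oddInv p)
    (fun b => evenInv p b * prefixSum (oddInv p) b) p
  rw [prefixSum_reflect (f := fun j => oddInv p j * _)
    (g := fun a => -(evenInv p a *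
      prefixSum (fun b => evenInv p b * prefixSum (oddInv p) b) a)) (fun n hn => by
      rw [oddInv_reflect hp hn, Nat.sub_sub_self hn, neg_mul]) (by simp [evenInv_zero])
      (by simp [evenInv_self]), prefixSum_neg] at h
  rw [← h, ← prefixSum_mul_left]
  refine prefixSum_congr fun a ha => ?_
  have h1 : ∀ j ∈ Finset.range (a + 1),
      oddInv p j * (evenInv p (a - j) * prefixSum (oddInv p) (a - j)) =
        oddInv p a * (oddInv p j * prefixSum (oddInv p) (a - j)) +
        oddInv p a * (evenInv p (a - j) * prefixSum (oddInv p) (a - j)) := by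
    intro j hj
    rcases (Nat.lt_succ_iff.1 (Finset.mem_range.1 hj)).eq_or_lt with rfl | hj'
    · simp [evenInv_zero, prefixSum_zero]
    · have := evenInv_mul_oddInv_of_pos (p := p) (i := a - j) (j := j) (by omega) (by omega)
      rw [Nat.sub_add_cancel hj'.le] at this
      linear_combination prefixSum (oddInv p) (a - j) * this
  have h2 := prefixSum_convolution (oddInv p) (oddInv p) a
  rw [prefixSum_congr fun b hb => sum_oddInv_mul_oddInv (hb.trans ha), prefixSum_mul_left] at h2
  have h3 := Finset.sum_flip (n := a) fun j => evenInv p j * prefixSum (oddInv p) j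
  rw [Finset.sum_congr rfl h1, Finset.sum_add_distrib, ← Finset.mul_sum, ← Finset.mul_sum, h3,
    Finset.sum_range_succ, Finset.sum_range_succ, Nat.sub_self, prefixSum_zero, mul_zero,
    add_zero]
  simp only [← prefixSum.eq_1]
  rw [← h2]
  linear_combination -prefixSum (oddInv p) a * evenInv_mul_oddInv (p := p) a

/-- The reversal `n ↦ p - n` exchanges the two parity patterns of depth three. -/
lemma prefixSum_evenInv_oddInv_evenInv (hp : Odd p) (h3 : (3 : ZMod p) ≠ 0) :
    prefixSum (fun a => evenInv p a *
        prefixSum (fun b => oddInv p b * prefixSum (evenInv p) b) a) p =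
      -prefixSum (fun a => oddInv p a *
        prefixSum (fun b => evenInv p b * prefixSum (oddInv p) b) a) p := by
  have hEO := prefixSum_evenInv_mul_oddInv hp h3
  have hst := prefixSum_mul_prefixSum (evenInv p) (oddInv p) p
  rw [hEO, prefixSum_congr fun a _ => evenInv_mul_oddInv a] at hst
  simp only [prefixSum, Finset.sum_const_zero, zero_add, add_zero] at hst
  simp only [← prefixSum.eq_1] at hst
  have hO : ∀ n ≤ p, prefixSum (oddInv p) (p - n) =
      prefixSum (evenInv p) (n + 1) - prefixSum (evenInv p) p := by
    intro n hn
    rw [prefixSum_sub_reflect (g := fun n => -evenInv p n) (fun n hn => oddInv_reflect hp hn)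
      (by simp [evenInv_self]) hn, prefixSum_neg, prefixSum_neg]
    ring
  have hEO' : ∀ n ≤ p, prefixSum (fun b => evenInv p b * prefixSum (oddInv p) b) (p - n) =
      prefixSum (fun b => oddInv p b * prefixSum (evenInv p) b) (n + 1) -
        prefixSum (evenInv p) p * prefixSum (oddInv p) (n + 1) := by
    intro n hn
    rw [prefixSum_sub_reflect (g := fun b => prefixSum (evenInv p) p * oddInv p b -
      oddInv p b * prefixSum (evenInv p) b) (fun n hn => ?_) (by simp [oddInv_self]) hn,
      prefixSum_sub, prefixSum_sub, prefixSum_mul_left, prefixSum_mul_left, hst]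
    · ring
    · rw [evenInv_reflect hp hn, hO n hn, prefixSum_succ]
      linear_combination -evenInv_mul_oddInv (p := p) n
  rw [prefixSum_reflect (f := fun a => oddInv p a * _) (g := fun a =>
      prefixSum (evenInv p) p * (evenInv p a * prefixSum (oddInv p) a) -
      evenInv p a * prefixSum (fun b => oddInv p b * prefixSum (evenInv p) b) a)
      (fun n hn => ?_) (by simp [evenInv_zero]) (by simp [evenInv_self]),
    prefixSum_sub, prefixSum_mul_left, hEO]
  · ring
  · rw [oddInv_reflect hp hn, hEO' n hn, prefixSum_succ, prefixSum_succ]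
    linear_combination (prefixSum (evenInv p) p - prefixSum (evenInv p) n) *
      evenInv_mul_oddInv (p := p) n

lemma seven_mul_prefixSum_oddInv_evenInv_oddInv (hp : Odd p) (h3 : (3 : ZMod p) ≠ 0) :
    7 * prefixSum (fun a => oddInv p a *
        prefixSum (fun b => evenInv p b * prefixSum (oddInv p) b) a) p =
      prefixSum (fun a => evenInv p a ^ 2 * prefixSum (oddInv p) a) p := by
  have h := prefixSum_mul_prefixSum (evenInv p)
    (fun b => evenInv p b * prefixSum (oddInv p) b) p
  have h1 : ∀ a, evenInv p a * prefixSum (oddInv p) a * prefixSum (evenInv p) a =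
      evenInv p a * prefixSum (fun b => evenInv p b * prefixSum (oddInv p) b) a +
      evenInv p a * prefixSum (fun b => oddInv p b * prefixSum (evenInv p) b) a := by
    intro a
    have h2 := prefixSum_mul_prefixSum (evenInv p) (oddInv p) a
    rw [prefixSum_congr fun a _ => evenInv_mul_oddInv a] at h2
    have h3 : prefixSum (fun _ => (0 : ZMod p)) a = 0 := by simp [prefixSum]
    linear_combination evenInv p a * (h2 + h3)
  simp only [h1] at h
  rw [prefixSum_evenInv_mul_oddInv hp h3, prefixSum_add, prefixSum_evenInv_oddInv_evenInv hp h3,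
    prefixSum_congr (f := fun a => evenInv p a * (evenInv p a * _))
      (g := fun a => evenInv p a ^ 2 * prefixSum (oddInv p) a) fun a _ => by ring] at h
  linear_combination h + 2 * three_mul_prefixSum_oddInv_evenInv_oddInv hp

lemma prefixSum_eq_sum_zmod (f : ZMod p → ZMod p) :
    prefixSum (fun n => f n) p = ∑ x : ZMod p, f x := by
  refine Finset.sum_bij' (fun n _ => (n : ZMod p)) (fun x _ => x.val) ?_ ?_ ?_ ?_ ?_
  · simp
  · intro x _; exact Finset.mem_range.2 (ZMod.val_lt x)
  · intro n hn; exact ZMod.val_cast_of_lt (Finset.mem_range.1 hn)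
  · simp
  · simp

lemma prefixSum_natCast_pow {k : ℕ} (hk : k < p - 1) :
    prefixSum (fun n => (n : ZMod p) ^ k) p = 0 := by
  rw [prefixSum_eq_sum_zmod (p := p) (fun x => x ^ k)]
  exact FiniteField.sum_pow_lt_card_sub_one _ _ (by rwa [ZMod.card])

lemma inv_sq_eq_pow (h5 : 3 < p) (x : ZMod p) : x⁻¹ ^ 2 = x ^ (p - 3) := by
  rcases eq_or_ne x 0 with rfl | hx
  · rw [inv_zero, zero_pow two_ne_zero, zero_pow (by omega)]
  · have h := ZMod.pow_card_sub_one_eq_one hx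
    rw [show p - 1 = p - 3 + 2 by omega, pow_add] at h
    rw [inv_pow]
    exact (eq_inv_of_mul_eq_one_left h).symm

lemma prefixSum_inv_sq (h5 : 3 < p) : prefixSum (fun n => (n : ZMod p)⁻¹ ^ 2) p = 0 := by
  simp only [inv_sq_eq_pow h5]
  exact prefixSum_natCast_pow (by omega)

lemma oddInv_add_evenInv (n : ℕ) : oddInv p n + evenInv p n = (n : ZMod p)⁻¹ := by
  unfold evenInv oddInv
  rcases Nat.even_or_odd n with h | h
  · simp [h]
  · simp [h]

lemma prefixSum_evenInv_sq (hp : Odd p) :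
    prefixSum (fun n => evenInv p n ^ 2) p = prefixSum (fun n => oddInv p n ^ 2) p :=
  prefixSum_reflect (fun n hn => by rw [evenInv_reflect hp hn, neg_sq])
    (by simp [oddInv_zero]) (by simp [oddInv_self])

lemma inv_sq_eq_add (n : ℕ) : (n : ZMod p)⁻¹ ^ 2 = oddInv p n ^ 2 + evenInv p n ^ 2 := by
  rw [← oddInv_add_evenInv]
  linear_combination 2 * evenInv_mul_oddInv (p := p) n

lemma prefixSum_oddInv_sq (hp : Odd p) (h5 : 3 < p) :
    prefixSum (fun n => oddInv p n ^ 2) p = 0 := by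
  have h := prefixSum_inv_sq h5
  simp only [inv_sq_eq_add] at h
  rw [prefixSum_add, prefixSum_evenInv_sq hp] at h
  have h2 : (2 : ZMod p) ≠ 0 := natCast_ne_zero_of_lt (n := 2) two_pos (by omega)
  refine (mul_eq_zero.1 ?_).resolve_left h2
  linear_combination h

lemma prefixSum_evenInv_sq_mul_oddInv (hp : Odd p) (h5 : 3 < p) :
    prefixSum (fun a => evenInv p a ^ 2 * prefixSum (oddInv p) a) p =
      prefixSum (fun a => oddInv p a ^ 2 * prefixSum (evenInv p) a) p := by
  rw [prefixSum_reflect (g := fun a => oddInv p a ^ 2 * prefixSum (evenInv p) a -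
      prefixSum (evenInv p) p * oddInv p a ^ 2) (fun n hn => ?_) (by simp [oddInv_zero])
      (by simp [oddInv_self]), prefixSum_sub, prefixSum_mul_left, prefixSum_oddInv_sq hp h5]
  · ring
  · rw [evenInv_reflect hp hn, prefixSum_sub_reflect (g := fun n => -evenInv p n)
      (fun n hn => oddInv_reflect hp hn) (by simp [evenInv_self]) hn, prefixSum_neg,
      prefixSum_neg, prefixSum_succ]
    linear_combination oddInv p n * evenInv_mul_oddInv (p := p) n

lemma two_mul_prefixSum_evenInv_sq_mul_oddInv (hp : Odd p) (h5 : 3 < p) :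
    2 * prefixSum (fun a => evenInv p a ^ 2 * prefixSum (oddInv p) a) p =
      -(prefixSum (fun a => evenInv p a * prefixSum (fun b => oddInv p b ^ 2) a) p +
        prefixSum (fun a => oddInv p a * prefixSum (fun b => evenInv p b ^ 2) a) p) := by
  have h1 := prefixSum_mul_prefixSum (fun a => evenInv p a ^ 2) (oddInv p) p
  have h2 := prefixSum_mul_prefixSum (fun a => oddInv p a ^ 2) (evenInv p) p
  rw [prefixSum_evenInv_sq hp, prefixSum_oddInv_sq hp h5,
    prefixSum_congr (f := fun a => evenInv p a ^ 2 * oddInv p a) (g := fun _ => 0) fun a _ => by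
      linear_combination evenInv p a * evenInv_mul_oddInv (p := p) a] at h1
  rw [prefixSum_oddInv_sq hp h5, ← prefixSum_evenInv_sq_mul_oddInv hp h5,
    prefixSum_congr (f := fun a => oddInv p a ^ 2 * evenInv p a) (g := fun _ => 0) fun a _ => by
      linear_combination oddInv p a * evenInv_mul_oddInv (p := p) a] at h2
  have h3 : prefixSum (fun _ => (0 : ZMod p)) p = 0 := by simp [prefixSum]
  linear_combination -h1 - h2 - 2 * h3

lemma prefixSum_add_self {K : Type*} [CommRing K] (f : ℕ → K) (n m : ℕ) :
    prefixSum f (n + m) = prefixSum f m + prefixSum (fun i => f (i + m)) n := by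
  rw [add_comm n m, prefixSum, Finset.sum_range_add]
  simp only [prefixSum, add_comm]

/-- Doubling the outer variable of a double harmonic sum over a full period. -/
lemma seven_mul_prefixSum_inv_mul_inv_sq (hp : Odd p) (h5 : 3 < p) :
    7 * prefixSum (fun a => (a : ZMod p)⁻¹ * prefixSum (fun b => (b : ZMod p)⁻¹ ^ 2) a) p =
      8 * (prefixSum (fun a => evenInv p a * prefixSum (fun b => oddInv p b ^ 2) a) p +
        prefixSum (fun a => oddInv p a * prefixSum (fun b => evenInv p b ^ 2) a) p) := by
  have h2 : (2 : ZMod p) ≠ 0 := natCast_ne_zero_of_lt (n := 2) two_pos (by omega)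
  have hodd := prefixSum_two_mul hp
    fun x => (x : ZMod p)⁻¹ * prefixSum (fun b => oddInv p b ^ 2) x
  have hall := prefixSum_two_mul hp
    fun x => (x : ZMod p)⁻¹ * prefixSum (fun b => (b : ZMod p)⁻¹ ^ 2) x
  rw [prefixSum_congr (f := fun x => if Even x then _ else _)
      (g := fun a => evenInv p a * prefixSum (fun b => oddInv p b ^ 2) a)
      fun a _ => by simp only [evenInv, ite_mul, zero_mul],
    prefixSum_congr (f := fun x => if Odd x then _ else _)
      (g := fun a => oddInv p a * prefixSum (fun b => evenInv p b ^ 2) a)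
      fun a _ => by
        rw [prefixSum_add_self _ a p, prefixSum_oddInv_sq hp h5]
        simp only [oddInv_add_self hp]
        simp [oddInv]] at hodd
  rw [← prefixSum_add, prefixSum_congr (f := fun x => (if Even x then _ else _) + _)
      (g := fun a => (a : ZMod p)⁻¹ * prefixSum (fun b => (b : ZMod p)⁻¹ ^ 2) a)
      fun a _ => by
        rw [prefixSum_add_self _ a p, prefixSum_inv_sq h5]
        rcases Nat.even_or_odd a with h | h <;> simp [h, Nat.not_odd_iff_even, Nat.not_even_iff_odd]] at hall
  have hdouble : ∀ a, 4 * prefixSum (fun b => (b : ZMod p)⁻¹ ^ 2) (2 * a) =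
      4 * prefixSum (fun b => oddInv p b ^ 2) (2 * a) +
        prefixSum (fun b => (b : ZMod p)⁻¹ ^ 2) a := by
    intro a
    induction a with
    | zero => simp [prefixSum_zero]
    | succ a ih =>
      have e : ¬ Odd (2 * a) := by simp
      have e' : Odd (2 * a + 1) := ⟨a, rfl⟩
      have h4 : (4 : ZMod p) * ((2 * a : ℕ) : ZMod p)⁻¹ ^ 2 = (a : ZMod p)⁻¹ ^ 2 := by
        push_cast
        rw [mul_inv, mul_pow]
        field_simp
        norm_num
      rw [mul_add_one, show 2 * a + 2 = 2 * a + 1 + 1 from rfl]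
      simp only [prefixSum_succ, oddInv, if_neg e, if_pos e']
      simp only [← oddInv.eq_1]
      linear_combination ih + h4
  have hZ : 8 * prefixSum (fun a => ((2 * a : ℕ) : ZMod p)⁻¹ *
        prefixSum (fun b => (b : ZMod p)⁻¹ ^ 2) (2 * a)) p =
      8 * prefixSum (fun a => ((2 * a : ℕ) : ZMod p)⁻¹ *
        prefixSum (fun b => oddInv p b ^ 2) (2 * a)) p +
      prefixSum (fun a => (a : ZMod p)⁻¹ * prefixSum (fun b => (b : ZMod p)⁻¹ ^ 2) a) p := by
    rw [← prefixSum_mul_left, ← prefixSum_mul_left, ← prefixSum_add]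
    refine prefixSum_congr fun a _ => ?_
    have h : 2 * ((2 * a : ℕ) : ZMod p)⁻¹ = (a : ZMod p)⁻¹ := by
      push_cast
      rw [mul_inv, mul_inv_cancel_left₀ h2]
    rw [← h]
    linear_combination 2 * ((2 * a : ℕ) : ZMod p)⁻¹ * hdouble a
  rw [hodd, hall] at hZ
  linear_combination hZ

end Relations

section Bernoulli

variable {p : ℕ} [Fact p.Prime]

lemma ratCast_sum {ι : Type*} (s : Finset ι) (f : ι → ℚ)
    (h : ∀ i ∈ s, ((f i).den : ZMod p) ≠ 0) :
    ((∑ i ∈ s, f i).den : ZMod p) ≠ 0 ∧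
      ((∑ i ∈ s, f i : ℚ) : ZMod p) = ∑ i ∈ s, (f i : ZMod p) := by
  induction s using Finset.cons_induction with
  | empty => simp
  | cons a s ha ih =>
    obtain ⟨h1, h2⟩ := ih fun i hi => h i (Finset.mem_cons_of_mem hi)
    have h0 := h a (Finset.mem_cons_self a s)
    rw [Finset.sum_cons, Finset.sum_cons, Rat.cast_add_of_ne_zero h0 h1, h2]
    refine ⟨fun hd => ?_, rfl⟩
    have := (Nat.cast_dvd_cast (α := ZMod p) (Rat.add_den_dvd (f a) (∑ i ∈ s, f i)))
    rw [hd, zero_dvd_iff, Nat.cast_mul] at this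
    exact mul_ne_zero h0 h1 this

lemma den_mul_ne_zero {x y : ℚ} (hx : (x.den : ZMod p) ≠ 0) (hy : (y.den : ZMod p) ≠ 0) :
    ((x * y).den : ZMod p) ≠ 0 := by
  intro hd
  have := (Nat.cast_dvd_cast (α := ZMod p) (Rat.mul_den_dvd x y))
  rw [hd, zero_dvd_iff, Nat.cast_mul] at this
  exact mul_ne_zero hx hy this

lemma den_inv_natCast_ne_zero {n : ℕ} (hn : (n : ZMod p) ≠ 0) :
    (((n : ℚ)⁻¹).den : ZMod p) ≠ 0 := by
  have h0 : n ≠ 0 := by rintro rfl; simp at hn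
  rwa [Rat.inv_natCast_den, if_neg h0]

lemma den_natCast_ne_zero (n : ℕ) : ((n : ℚ).den : ZMod p) ≠ 0 := by simp

/-- Bernoulli numbers of index less than `p - 1` are `p`-integral. -/
lemma den_bernoulli_ne_zero {n : ℕ} (hn : n + 1 < p) : ((bernoulli n).den : ZMod p) ≠ 0 := by
  induction n using Nat.strong_induction_on with
  | _ n ih =>
    rcases Nat.eq_zero_or_pos n with rfl | hpos
    · simp
    have h := sum_bernoulli (n + 1)
    rw [if_neg (by omega), Finset.sum_range_succ, Nat.choose_succ_self_right] at h
    have hn1 : ((n + 1 : ℕ) : ℚ) ≠ 0 := by positivity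
    have hb : bernoulli n = ((n + 1 : ℕ) : ℚ)⁻¹ *
        ∑ i ∈ Finset.range n, ((-1 : ℤ) : ℚ) * (((n + 1).choose i : ℚ) * bernoulli i) := by
      rw [← Finset.mul_sum, eq_inv_mul_iff_mul_eq₀ hn1]
      push_cast at h ⊢
      linear_combination h
    rw [hb]
    refine den_mul_ne_zero (den_inv_natCast_ne_zero (natCast_ne_zero_of_lt n.succ_pos hn))
      (ratCast_sum _ _ fun i hi => ?_).1
    have hi' := Finset.mem_range.1 hi
    exact den_mul_ne_zero (by rw [Rat.den_intCast]; simp)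
      (den_mul_ne_zero (den_natCast_ne_zero _) (ih i hi' (by omega)))

/-- Faulhaber's formula modulo `p`. -/
lemma prefixSum_pow_eq {k : ℕ} (hk : k + 1 < p) (n : ℕ) :
    prefixSum (fun b => (b : ZMod p) ^ k) n = ∑ i ∈ Finset.range (k + 1),
      (bernoulli i : ZMod p) * ((k + 1).choose i : ZMod p) * (n : ZMod p) ^ (k + 1 - i) *
        ((k + 1 : ℕ) : ZMod p)⁻¹ := by
  have hk0 : ((k + 1 : ℕ) : ZMod p) ≠ 0 := natCast_ne_zero_of_lt k.succ_pos hk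
  have hinv := den_inv_natCast_ne_zero hk0
  have h := sum_range_pow n k
  have hterm : ∀ i ∈ Finset.range (k + 1),
      bernoulli i * ((k + 1).choose i : ℚ) * (n : ℚ) ^ (k + 1 - i) / ((k : ℚ) + 1) =
        bernoulli i * (((k + 1).choose i * n ^ (k + 1 - i) : ℕ) : ℚ) * ((k + 1 : ℕ) : ℚ)⁻¹ := by
    intro i _
    push_cast
    ring
  rw [Finset.sum_congr rfl hterm] at h
  have hden : ∀ i ∈ Finset.range (k + 1), ((bernoulli i).den : ZMod p) ≠ 0 := fun i hi =>
    den_bernoulli_ne_zero (by have := Finset.mem_range.1 hi; omega)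
  have h' := congrArg (fun x : ℚ => (x : ZMod p)) h
  rw [(ratCast_sum _ _ fun i hi => den_mul_ne_zero
    (den_mul_ne_zero (hden i hi) (den_natCast_ne_zero _)) hinv).2,
    (ratCast_sum _ _ fun i _ => by simp).2] at h'
  have hl : ∀ i : ℕ, (((i : ℚ) ^ k : ℚ) : ZMod p) = (i : ZMod p) ^ k := fun i => by
    rw [← Nat.cast_pow, Rat.cast_natCast, Nat.cast_pow]
  simp only [hl] at h'
  rw [prefixSum, h']
  refine Finset.sum_congr rfl fun i hi => ?_
  rw [Rat.cast_mul_of_ne_zero (den_mul_ne_zero (hden i hi) (den_natCast_ne_zero _)) hinv,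
    Rat.cast_mul_of_ne_zero (hden i hi) (den_natCast_ne_zero _), Rat.cast_natCast,
    Rat.cast_inv_nat]
  push_cast
  ring

/-- The double harmonic sum `∑ 1 / (a b²)` over `p > a > b > 0`. -/
lemma prefixSum_inv_mul_inv_sq (h5 : 3 < p) :
    prefixSum (fun a => (a : ZMod p)⁻¹ * prefixSum (fun b => (b : ZMod p)⁻¹ ^ 2) a) p =
      -(bernoulli (p - 3) : ZMod p) := by
  obtain ⟨m, rfl⟩ : ∃ m, p = m + 3 := ⟨p - 3, by omega⟩
  simp only [inv_sq_eq_pow h5, Nat.add_sub_cancel]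
  have h1 : ∀ a < m + 3, (a : ZMod (m + 3))⁻¹ * prefixSum (fun b => (b : ZMod (m + 3)) ^ m) a =
      ∑ i ∈ Finset.range (m + 1), (bernoulli i : ZMod (m + 3)) * ((m + 1).choose i : ZMod (m + 3)) *
        ((m + 1 : ℕ) : ZMod (m + 3))⁻¹ * ((a : ZMod (m + 3))⁻¹ * (a : ZMod (m + 3)) ^ (m + 1 - i)) := by
    intro a _
    rw [prefixSum_pow_eq (by omega), Finset.mul_sum]
    exact Finset.sum_congr rfl fun i _ => by ring
  rw [prefixSum_congr h1, prefixSum, Finset.sum_comm]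
  have hm : ((m + 1 : ℕ) : ZMod (m + 3)) ≠ 0 := natCast_ne_zero_of_lt m.succ_pos (by omega)
  rw [Finset.sum_range_succ, Finset.sum_eq_zero fun i hi => ?_, ← Finset.mul_sum, zero_add,
    Nat.choose_succ_self_right, mul_assoc (bernoulli m : ZMod (m + 3)), mul_inv_cancel₀ hm, mul_one]
  · have : ∑ a ∈ Finset.range (m + 3),
        (a : ZMod (m + 3))⁻¹ * (a : ZMod (m + 3)) ^ (m + 1 - m) = -1 := by
      rw [Finset.sum_range_succ' _ (m + 2), Finset.sum_congr rfl
        (g := fun _ => 1) fun i hi => ?_]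
      · have : ((m + 3 : ℕ) : ZMod (m + 3)) = 0 := CharP.cast_eq_zero _ _
        simp
        push_cast at this
        linear_combination this
      · rw [Nat.add_sub_cancel_left, pow_one]
        exact inv_mul_cancel₀ (natCast_ne_zero_of_lt i.succ_pos
          (by have := Finset.mem_range.1 hi; omega))
    rw [this, mul_neg_one]
  · have hi' := Finset.mem_range.1 hi
    rw [← Finset.mul_sum]
    have h2 : ∀ a : ℕ, (a : ZMod (m + 3))⁻¹ * (a : ZMod (m + 3)) ^ (m + 1 - i) =
        (a : ZMod (m + 3)) ^ (m - i) := by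
      intro a
      rcases eq_or_ne (a : ZMod (m + 3)) 0 with h | h
      · rw [h, inv_zero, zero_mul, zero_pow (by omega)]
      · rw [show m + 1 - i = m - i + 1 by omega, pow_succ', inv_mul_cancel_left₀ h]
    have h3 := prefixSum_natCast_pow (p := m + 3) (k := m - i) (by omega)
    rw [prefixSum] at h3
    simp only [h2, h3, mul_zero]

end Bernoulli

section TripleSum

variable {p : ℕ}

lemma sum_fin_three_arrow {K : Type*} [AddCommMonoid K] (F : (Fin 3 → Fin p) → K) :
    ∑ n : Fin 3 → Fin p, F n = ∑ a : Fin p, ∑ b : Fin p, ∑ c : Fin p, F ![a, b, c] := by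
  simp only [← Fintype.sum_prod_type']
  refine Fintype.sum_equiv
    { toFun := fun n : Fin 3 → Fin p => (n 0, n 1, n 2)
      invFun := fun x => ![x.1, x.2.1, x.2.2]
      left_inv := fun n => by ext i; fin_cases i <;> rfl
      right_inv := fun x => rfl } F (fun x => F ![x.1, x.2.1, x.2.2]) fun n => congrArg F ?_
  ext i
  fin_cases i <;> rfl

lemma sum_fin_nested {K : Type*} [CommRing K] (f g h : ℕ → K) :
    ∑ a : Fin p, ∑ b : Fin p, ∑ c : Fin p,
      (if (b : ℕ) < a ∧ (c : ℕ) < b then f a * (g b * h c) else 0) =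
      prefixSum (fun a => f a * prefixSum (fun b => g b * prefixSum h b) a) p := by
  have key : ∀ (a : ℕ) (F : ℕ → K), a ≤ p →
      ∑ b : Fin p, (if (b : ℕ) < a then F b else 0) = prefixSum F a := by
    intro a F ha
    rw [Fin.sum_univ_eq_sum_range (fun b => if b < a then F b else 0), ← Finset.sum_filter,
      prefixSum]
    congr 1
    ext x
    simp only [Finset.mem_filter, Finset.mem_range]
    omega
  rw [← key p _ le_rfl]
  refine Finset.sum_congr rfl fun a _ => ?_
  rw [if_pos a.2, ← key a _ a.2.le, Finset.mul_sum]
  refine Finset.sum_congr rfl fun b _ => ?_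
  split_ifs with hb
  · rw [← key b _ b.2.le, Finset.mul_sum, Finset.mul_sum]
    refine Finset.sum_congr rfl fun c _ => ?_
    by_cases hc : (c : ℕ) < b <;> simp [hb, hc]
  · simp [hb]

/-- The general summand of `TsumP` and `SsumP` at `(1, 1, 1)`. -/
lemma sum_parity_three (f g h : ℕ → ZMod p) (r : ℕ → ℕ)
    (hf : ∀ n, f n = if n % 2 = r 0 then (n : ZMod p)⁻¹ else 0)
    (hg : ∀ n, g n = if n % 2 = r 1 then (n : ZMod p)⁻¹ else 0)
    (hh : ∀ n, h n = if n % 2 = r 2 then (n : ZMod p)⁻¹ else 0) :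
    (∑ n : Fin 3 → Fin p,
      if (∀ j, 0 < (n j : ℕ)) ∧ (∀ i j : Fin 3, i < j → (n j : ℕ) < (n i : ℕ)) ∧
        (∀ j : Fin 3, (n j : ℕ) % 2 = r j)
      then ∏ j, (((n j : ℕ) : ZMod p) ^ ([1, 1, 1] : List ℕ).get j)⁻¹
      else 0) =
      prefixSum (fun a => f a * prefixSum (fun b => g b * prefixSum h b) a) p := by
  rw [← sum_fin_nested, sum_fin_three_arrow]
  refine Finset.sum_congr rfl fun a _ => Finset.sum_congr rfl fun b _ =>
    Finset.sum_congr rfl fun c _ => ?_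
  rw [hf, hg, hh]
  have hP : (∀ j, 0 < ((![a, b, c] j : Fin p) : ℕ)) ∧
      (∀ i j : Fin 3, i < j → ((![a, b, c] j : Fin p) : ℕ) < (![a, b, c] i : Fin p)) ∧
        (∀ j : Fin 3, ((![a, b, c] j : Fin p) : ℕ) % 2 = r j) ↔
      0 < (c : ℕ) ∧ ((b : ℕ) < a ∧ (c : ℕ) < b) ∧
        (a : ℕ) % 2 = r 0 ∧ (b : ℕ) % 2 = r 1 ∧ (c : ℕ) % 2 = r 2 := by
    simp [Fin.forall_fin_succ]
    omega
  have hprod : ∏ j, ((((![a, b, c] j : Fin p) : ℕ) : ZMod p) ^ ([1, 1, 1] : List ℕ).get j)⁻¹ =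
      ((a : ℕ) : ZMod p)⁻¹ * (((b : ℕ) : ZMod p)⁻¹ * ((c : ℕ) : ZMod p)⁻¹) := by
    simp [Fin.prod_univ_succ]
  rw [hprod]
  simp only [hP]
  rcases Nat.eq_zero_or_pos (c : ℕ) with hc | hc
  · simp [hc, ZMod.inv_zero]
  · simp only [hc, true_and]
    split_ifs <;> simp_all

end TripleSum

lemma TsumP_one_one_one (p : ℕ) :
    TsumP p [1, 1, 1] = prefixSum (fun a => oddInv p a *
      prefixSum (fun b => evenInv p b * prefixSum (oddInv p) b) a) p :=
  sum_parity_three _ _ _ (fun j => (3 - j) % 2)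
    (fun n => by simp [oddInv, Nat.odd_iff]) (fun n => by simp [evenInv, Nat.even_iff])
    (fun n => by simp [oddInv, Nat.odd_iff])

lemma SsumP_one_one_one (p : ℕ) :
    SsumP p [1, 1, 1] = prefixSum (fun a => evenInv p a *
      prefixSum (fun b => oddInv p b * prefixSum (evenInv p) b) a) p :=
  sum_parity_three _ _ _ (fun j => (3 - 1 - j) % 2)
    (fun n => by simp [evenInv, Nat.even_iff]) (fun n => by simp [oddInv, Nat.odd_iff])
    (fun n => by simp [evenInv, Nat.even_iff])

lemma rQ_three_div_sixteen {p : ℕ} [Fact p.Prime] (h5 : 3 < p) :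
    16 * rQ p ((3/16) * (bernoulli (p - 3) / 3)) = (bernoulli (p - 3) : ZMod p) := by
  have h2 : (2 : ZMod p) ≠ 0 := natCast_ne_zero_of_lt (n := 2) two_pos (by omega)
  have h16 : ((16 : ℕ) : ZMod p) ≠ 0 := by
    have := pow_ne_zero 4 h2
    push_cast
    norm_num at this
    exact this
  rw [rQ, ← div_eq_mul_inv, ← Rat.cast_def,
    show (3/16 : ℚ) * (bernoulli (p - 3) / 3) = ((16 : ℕ) : ℚ)⁻¹ * bernoulli (p - 3) by
      push_cast; ring,
    Rat.cast_mul_of_ne_zero (den_inv_natCast_ne_zero h16) (den_bernoulli_ne_zero (by omega)),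
    Rat.cast_inv_nat, show (16 : ZMod p) = ((16 : ℕ) : ZMod p) by norm_num,
    mul_inv_cancel_left₀ h16]

/-- For all sufficiently large primes `p`,
`T_p(1,1,1) = (3/16)·(B_{p−3}/3)` and `S_p(1,1,1) = −(3/16)·(B_{p−3}/3)` in
`ℤ/pℤ`; i.e. `T_𝒜(1,1,1) = −S_𝒜(1,1,1) = (3/16)β₃`. -/
theorem T_S_one_one_one :
    ∃ N : ℕ, ∀ p : ℕ, N < p → p.Prime →
      TsumP p [1, 1, 1] = rQ p ((3/16) * (bernoulli (p - 3) / 3)) ∧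
      SsumP p [1, 1, 1] = -(rQ p ((3/16) * (bernoulli (p - 3) / 3))) := by
  refine ⟨7, fun p h7 hprime => ?_⟩
  have : Fact p.Prime := ⟨hprime⟩
  have hp : Odd p := hprime.odd_of_ne_two (by omega)
  have hne : ∀ n : ℕ, 0 < n → n < p → (n : ZMod p) ≠ 0 := fun _ => natCast_ne_zero_of_lt
  have h3 : (3 : ZMod p) ≠ 0 := hne 3 (by omega) (by omega)
  have hT := seven_mul_prefixSum_oddInv_evenInv_oddInv hp h3
  have hS := prefixSum_evenInv_oddInv_evenInv hp h3
  rw [← TsumP_one_one_one] at hT hS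
  rw [← SsumP_one_one_one] at hS
  have hX := two_mul_prefixSum_evenInv_sq_mul_oddInv hp (by omega)
  have hH := seven_mul_prefixSum_inv_mul_inv_sq hp (by omega)
  rw [prefixSum_inv_mul_inv_sq (by omega), ← rQ_three_div_sixteen (by omega)] at hH
  have h112 : (7 * 2 ^ 4 : ZMod p) ≠ 0 :=
    mul_ne_zero (hne 7 (by omega) (by omega)) (pow_ne_zero _ (hne 2 (by omega) (by omega)))
  have key : TsumP p [1, 1, 1] = rQ p ((3/16) * (bernoulli (p - 3) / 3)) := by
    refine mul_left_cancel₀ h112 ?_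
    linear_combination 16 * hT + 8 * hX + hH
  exact ⟨key, by rw [hS, key]⟩
end

section
/- The limit lim_{N→∞} Σ_{N ≥ n₁ > n₂ > n₃ ≥ 1} ((−1)^{n₁+n₂+n₃} + (−1)^{n₁+n₃} − (−1)^{n₁} − (−1)^{n₁+n₂}) / (n₁ n₂ n₃) exists and equals (3/4)·Σ_{n≥1} n^{−3}. Equivalently, ζ(1̄,1̄,1̄) + ζ(1̄,1,1̄) − ζ(1̄,1,1) − ζ(1̄,1̄,1) = (3/4)·ζ(3), which expresses the paper's evaluation T_⧢^𝒮(1,1,1) = (3/16)ζ(3) of the shuffle-regularized symmetric multiple T-value. -/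
open Filter

open MeasureTheory Set

/-- The odd harmonic sum `∑_{i < j} 1 / (2 i + 1)`. -/
noncomputable def oddHarmonic (j : ℕ) : ℝ := ∑ i ∈ Finset.range j, 1 / (2 * (i : ℝ) + 1)

/-- The nested sum `∑_{1 ≤ j ≤ m} oddHarmonic j / (2 j)`. -/
noncomputable def evenOddSum (m : ℕ) : ℝ :=
  ∑ k ∈ Finset.range m, oddHarmonic (k + 1) / (2 * ((k : ℝ) + 1))

lemma oddHarmonic_nonneg (j : ℕ) : 0 ≤ oddHarmonic j :=
  Finset.sum_nonneg fun _ _ => by positivity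

lemma evenOddSum_nonneg (m : ℕ) : 0 ≤ evenOddSum m :=
  Finset.sum_nonneg fun k _ => div_nonneg (oddHarmonic_nonneg _) (by positivity)

lemma evenOddSum_succ (m : ℕ) :
    evenOddSum (m + 1) = evenOddSum m + oddHarmonic (m + 1) / (2 * ((m : ℝ) + 1)) :=
  Finset.sum_range_succ _ _

lemma tendsto_evenOddSum_div : Tendsto (fun m : ℕ => 4 * evenOddSum m / (2 * (m : ℝ) + 1))
    atTop (nhds 0) := by
  have h0 : Tendsto (fun i : ℕ => 1 / (2 * (i : ℝ) + 1)) atTop (nhds 0) := by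
    refine squeeze_zero (fun i => by positivity) (fun i => ?_)
      (tendsto_one_div_add_atTop_nhds_zero_nat (𝕜 := ℝ))
    have : (0 : ℝ) ≤ i := Nat.cast_nonneg i
    gcongr
    linarith
  have h1 : Tendsto (fun k : ℕ => oddHarmonic (k + 1) / (2 * ((k : ℝ) + 1))) atTop (nhds 0) := by
    have := ((h0.cesaro.comp (tendsto_add_atTop_nat 1)).const_mul (1 / 2))
    simp only [mul_zero] at this
    refine this.congr fun k => ?_
    simp only [Function.comp, oddHarmonic]
    push_cast
    field_simp
  have h2 := h1.cesaro.const_mul 4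
  rw [mul_zero] at h2
  refine squeeze_zero (fun m => by have := evenOddSum_nonneg m; positivity) (fun m => ?_) h2
  change _ ≤ 4 * ((m : ℝ)⁻¹ * evenOddSum m)
  rcases Nat.eq_zero_or_pos m with rfl | hm
  · simp [evenOddSum]
  · have hm' : (0 : ℝ) < m := Nat.cast_pos.2 hm
    have := evenOddSum_nonneg m
    rw [show 4 * ((m : ℝ)⁻¹ * evenOddSum m) = 4 * evenOddSum m / m by field_simp]
    gcongr
    linarith

lemma sum_inv_odd_mul_inv_odd (k : ℕ) :
    ∑ i ∈ Finset.range (k + 1), 1 / (2 * (i : ℝ) + 1) * (1 / (2 * ((k - i : ℕ) : ℝ) + 1)) =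
      2 * (oddHarmonic (k + 1) / (2 * ((k : ℝ) + 1))) := by
  have hrefl : ∑ i ∈ Finset.range (k + 1), 1 / (2 * ((k - i : ℕ) : ℝ) + 1) =
      oddHarmonic (k + 1) := by
    rw [oddHarmonic, ← Finset.sum_range_reflect (fun i : ℕ => 1 / (2 * (i : ℝ) + 1))]
    simp only [Nat.add_sub_cancel]
  have : ∀ i ∈ Finset.range (k + 1),
      1 / (2 * (i : ℝ) + 1) * (1 / (2 * ((k - i : ℕ) : ℝ) + 1)) =
        1 / (2 * ((k : ℝ) + 1)) * (1 / (2 * (i : ℝ) + 1) + 1 / (2 * ((k - i : ℕ) : ℝ) + 1)) := by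
    intro i hi
    have hik : i ≤ k := Nat.lt_succ_iff.1 (Finset.mem_range.1 hi)
    obtain ⟨j, rfl⟩ := Nat.exists_eq_add_of_le hik
    rw [Nat.add_sub_cancel_left]
    push_cast
    field_simp
    ring
  rw [Finset.sum_congr rfl this, ← Finset.mul_sum, Finset.sum_add_distrib, hrefl]
  rw [← oddHarmonic]
  ring

lemma hasSum_evenOddSum_mul_pow {t : ℝ} (h0 : 0 < t) (h1 : t < 1) :
    HasSum (fun m : ℕ => 4 * evenOddSum (m + 1) * (t ^ (2 * m + 2) * (1 - t)))
      ((Real.log (1 + t) - Real.log (1 - t)) ^ 2 / (2 * (1 + t))) := by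
  have hL := Real.hasSum_log_sub_log_of_abs_lt_one (x := t) (by rw [abs_of_pos h0]; exact h1)
  set L := Real.log (1 + t) - Real.log (1 - t)
  have hLn := hL.summable.norm
  have hsq := hasSum_sum_range_mul_of_summable_norm hLn hLn
  rw [hL.tsum_eq] at hsq
  have hsq' : HasSum (fun k : ℕ => 8 * (oddHarmonic (k + 1) / (2 * ((k : ℝ) + 1))) *
      t ^ (2 * k + 2)) (L * L) := by
    convert! hsq using 1
    · ext k
      rw [show 8 * (oddHarmonic (k + 1) / (2 * ((k : ℝ) + 1))) * t ^ (2 * k + 2) =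
        2 * (oddHarmonic (k + 1) / (2 * ((k : ℝ) + 1))) * (4 * t ^ (2 * k + 2)) by ring,
        ← sum_inv_odd_mul_inv_odd, Finset.sum_mul]
      refine Finset.sum_congr rfl fun i hi => ?_
      have hik : i ≤ k := Nat.lt_succ_iff.1 (Finset.mem_range.1 hi)
      obtain ⟨j, rfl⟩ := Nat.exists_eq_add_of_le hik
      rw [Nat.add_sub_cancel_left]
      ring
  have ht2 : t ^ 2 < 1 := by nlinarith
  have hgeo := hasSum_geometric_of_lt_one (sq_nonneg t) ht2
  have hprod := hasSum_sum_range_mul_of_summable_norm hsq'.summable.norm hgeo.summable.norm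
  rw [hsq'.tsum_eq, hgeo.tsum_eq] at hprod
  have hfin := hprod.mul_right ((1 - t) / 2)
  have hval : L * L * (1 - t ^ 2)⁻¹ * ((1 - t) / 2) = L ^ 2 / (2 * (1 + t)) := by
    have : 1 - t ≠ 0 := by linarith
    have : 1 + t ≠ 0 := by linarith
    rw [show 1 - t ^ 2 = (1 - t) * (1 + t) by ring]
    field_simp
  rw [hval] at hfin
  convert! hfin using 2 with m
  rw [evenOddSum, Finset.mul_sum, Finset.sum_mul, Finset.sum_mul]
  refine Finset.sum_congr rfl fun k hk => ?_
  have hik : k ≤ m := Nat.lt_succ_iff.1 (Finset.mem_range.1 hk)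
  obtain ⟨j, rfl⟩ := Nat.exists_eq_add_of_le hik
  rw [Nat.add_sub_cancel_left, ← pow_mul]
  ring

lemma lintegral_Ioo_of_hasDerivAt_of_nonneg {F f : ℝ → ℝ} {a b : ℝ} (hab : a ≤ b)
    (hF : ContinuousOn F (Icc a b)) (hd : ∀ x ∈ Ioo a b, HasDerivAt F (f x) x)
    (hf : ∀ x ∈ Ioo a b, 0 ≤ f x) :
    ∫⁻ x in Ioo a b, ENNReal.ofReal (f x) = ENNReal.ofReal (F b - F a) := by
  have hint := intervalIntegral.integrableOn_deriv_of_nonneg hF hd hf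
  rw [← intervalIntegral.integral_eq_sub_of_hasDerivAt_of_le hab hF hd
    ((intervalIntegrable_iff_integrableOn_Ioc_of_le hab).2 hint),
    intervalIntegral.integral_of_le hab, integral_Ioc_eq_integral_Ioo,
    ofReal_integral_eq_lintegral_ofReal (hint.mono_set Ioo_subset_Ioc_self)]
  exact (ae_restrict_iff' measurableSet_Ioo).2 (Eventually.of_forall hf)

lemma lintegral_pow_mul_one_sub (m : ℕ) :
    ∫⁻ t in Ioo (0 : ℝ) 1, ENNReal.ofReal (t ^ m * (1 - t)) =
      ENNReal.ofReal (1 / ((m : ℝ) + 1) - 1 / ((m : ℝ) + 2)) := by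
  rw [lintegral_Ioo_of_hasDerivAt_of_nonneg
    (F := fun t => t ^ (m + 1) / ((m : ℝ) + 1) - t ^ (m + 2) / ((m : ℝ) + 2)) zero_le_one
    (by fun_prop)]
  · simp
  · intro x _
    have h := ((hasDerivAt_pow (m + 1) x).div_const ((m : ℝ) + 1)).sub
      ((hasDerivAt_pow (m + 2) x).div_const ((m : ℝ) + 2))
    convert! h using 1
    push_cast
    field_simp
    ring
  · exact fun x hx => mul_nonneg (pow_nonneg hx.1.le _) (sub_nonneg.2 hx.2.le)

lemma continuousOn_mul_log_sq : ContinuousOn (fun s : ℝ => s * Real.log s ^ 2) (Icc 0 1) := by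
  have h : Continuous fun s : ℝ => 4 * (√s * Real.log √s) ^ 2 :=
    ((Real.continuous_mul_log.comp Real.continuous_sqrt).pow 2).const_mul 4
  refine h.continuousOn.congr fun s hs => ?_
  simp only
  rw [Real.log_sqrt hs.1, mul_pow, Real.sq_sqrt hs.1]
  ring

/-- An antiderivative of `s ^ m * log s ^ 2`. -/
noncomputable def powLogSqPrimitive (m : ℕ) (s : ℝ) : ℝ :=
  s ^ m * (s * Real.log s ^ 2 / ((m : ℝ) + 1) - 2 * (s * Real.log s) / ((m : ℝ) + 1) ^ 2 +
    2 * s / ((m : ℝ) + 1) ^ 3)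

lemma continuousOn_powLogSqPrimitive (m : ℕ) : ContinuousOn (powLogSqPrimitive m) (Icc 0 1) := by
  have h1 := continuousOn_mul_log_sq
  have h2 : ContinuousOn (fun s : ℝ => s * Real.log s) (Icc 0 1) :=
    Real.continuous_mul_log.continuousOn
  unfold powLogSqPrimitive
  fun_prop

lemma hasDerivAt_powLogSqPrimitive (m : ℕ) {s : ℝ} (hs : 0 < s) :
    HasDerivAt (powLogSqPrimitive m) (s ^ m * Real.log s ^ 2) s := by
  have hlog := Real.hasDerivAt_log hs.ne'
  have h := (hasDerivAt_pow (m + 1) s).mul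
    ((((hlog.pow 2).div_const ((m : ℝ) + 1)).sub
      ((hlog.const_mul 2).div_const (((m : ℝ) + 1) ^ 2))).add_const (2 / ((m : ℝ) + 1) ^ 3))
  convert! h using 1
  · ext x
    simp only [powLogSqPrimitive, Pi.mul_apply, Pi.sub_apply, Pi.pow_apply]
    ring
  · simp only [Pi.sub_apply, Pi.pow_apply]
    push_cast
    field_simp
    ring

lemma lintegral_pow_mul_one_sub_mul_log_sq (n : ℕ) :
    ∫⁻ s in Ioo (0 : ℝ) 1, ENNReal.ofReal (s ^ n * (1 - s) * Real.log s ^ 2) =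
      ENNReal.ofReal (2 / ((n : ℝ) + 1) ^ 3 - 2 / ((n : ℝ) + 2) ^ 3) := by
  rw [lintegral_Ioo_of_hasDerivAt_of_nonneg
    (F := fun s => powLogSqPrimitive n s - powLogSqPrimitive (n + 1) s) zero_le_one
    ((continuousOn_powLogSqPrimitive n).sub (continuousOn_powLogSqPrimitive (n + 1)))]
  · simp only [powLogSqPrimitive, Real.log_one, Real.log_zero]
    push_cast
    congr 1
    simp
    ring
  · intro x hx
    convert! (hasDerivAt_powLogSqPrimitive n hx.1).sub
      (hasDerivAt_powLogSqPrimitive (n + 1) hx.1) using 1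
    ring
  · exact fun x hx => mul_nonneg (mul_nonneg (pow_nonneg hx.1.le _) (sub_nonneg.2 hx.2.le))
      (sq_nonneg _)

lemma summable_one_div_succ_pow_three : Summable fun n : ℕ => 1 / ((n : ℝ) + 1) ^ 3 := by
  have := (summable_nat_add_iff 1).2 (Real.summable_one_div_nat_pow.2 (by norm_num : 1 < 3))
  simpa using this

lemma hasSum_alternating_cubes :
    HasSum (fun n : ℕ => 1 / (2 * (n : ℝ) + 1) ^ 3 - 1 / (2 * (n : ℝ) + 2) ^ 3)
      (3 / 4 * ∑' n : ℕ, 1 / ((n : ℝ) + 1) ^ 3) := by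
  have hs := summable_one_div_succ_pow_three
  have he : Summable fun n : ℕ => 1 / (2 * (n : ℝ) + 1) ^ 3 := by
    simpa [Function.comp_def] using
      hs.comp_injective (mul_right_injective₀ (two_ne_zero (α := ℕ)))
  have ho : HasSum (fun n : ℕ => 1 / (2 * (n : ℝ) + 2) ^ 3)
      (1 / 8 * ∑' n : ℕ, 1 / ((n : ℝ) + 1) ^ 3) := by
    convert! hs.hasSum.mul_left (1 / 8) using 2 with n
    field_simp
    ring
  have h2 : HasSum (fun n : ℕ => 1 / ((n : ℝ) + 1) ^ 3)
      (∑' n : ℕ, 1 / (2 * (n : ℝ) + 1) ^ 3 + 1 / 8 * ∑' n : ℕ, 1 / ((n : ℝ) + 1) ^ 3) := by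
    refine HasSum.even_add_odd ?_ ?_
    · simpa using he.hasSum
    · convert! ho using 3 with n
      push_cast
      ring
  have h3 := h2.tsum_eq
  convert! he.hasSum.sub ho using 1
  linarith

lemma lintegral_log_sq_div :
    ∫⁻ s in Ioo (0 : ℝ) 1, ENNReal.ofReal (Real.log s ^ 2 / (2 * (1 + s))) =
      ENNReal.ofReal (3 / 4 * ∑' n : ℕ, 1 / ((n : ℝ) + 1) ^ 3) := by
  have hnn : ∀ n : ℕ, 0 ≤ 1 / (2 * (n : ℝ) + 1) ^ 3 - 1 / (2 * (n : ℝ) + 2) ^ 3 := fun n => by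
    rw [sub_nonneg]
    gcongr
    norm_num
  rw [← hasSum_alternating_cubes.tsum_eq,
    ENNReal.ofReal_tsum_of_nonneg hnn hasSum_alternating_cubes.summable]
  have hterm : ∀ n : ℕ, ENNReal.ofReal (1 / (2 * (n : ℝ) + 1) ^ 3 - 1 / (2 * (n : ℝ) + 2) ^ 3) =
      ∫⁻ s in Ioo (0 : ℝ) 1,
        ENNReal.ofReal (1 / 2) * ENNReal.ofReal (s ^ (2 * n) * (1 - s) * Real.log s ^ 2) := by
    intro n
    rw [lintegral_const_mul _ (by fun_prop), lintegral_pow_mul_one_sub_mul_log_sq,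
      ← ENNReal.ofReal_mul (by norm_num)]
    push_cast
    congr 1
    ring
  rw [tsum_congr hterm, ← lintegral_tsum fun n => by fun_prop]
  refine setLIntegral_congr_fun measurableSet_Ioo fun s hs => ?_
  have hpos : ∀ n : ℕ, 0 ≤ 1 / 2 * (s ^ (2 * n) * (1 - s) * Real.log s ^ 2) := fun n => by
    have := hs.1.le
    have := sub_nonneg.2 hs.2.le
    positivity
  have hsum : HasSum (fun n : ℕ => 1 / 2 * (s ^ (2 * n) * (1 - s) * Real.log s ^ 2))
      (Real.log s ^ 2 / (2 * (1 + s))) := by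
    have hgeo := (hasSum_geometric_of_lt_one (sq_nonneg s)
      (by nlinarith [hs.1, hs.2])).mul_right (1 / 2 * ((1 - s) * Real.log s ^ 2))
    have h1 : 1 - s ≠ 0 := by linarith [hs.2]
    have h2 : 1 + s ≠ 0 := by linarith [hs.1]
    convert! hgeo using 1
    · ext n
      rw [← pow_mul]
      ring
    · rw [show 1 - s ^ 2 = (1 - s) * (1 + s) by ring]
      field_simp
  simp_rw [← ENNReal.ofReal_mul (by norm_num : (0 : ℝ) ≤ 1 / 2)]
  rw [← ENNReal.ofReal_tsum_of_nonneg hpos hsum.summable, hsum.tsum_eq]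

lemma lintegral_artanh_sq_div :
    ∫⁻ t in Ioo (0 : ℝ) 1,
        ENNReal.ofReal ((Real.log (1 + t) - Real.log (1 - t)) ^ 2 / (2 * (1 + t))) =
      ∫⁻ s in Ioo (0 : ℝ) 1, ENNReal.ofReal (Real.log s ^ 2 / (2 * (1 + s))) := by
  set f : ℝ → ℝ := fun s => (1 - s) / (1 + s) with hf
  have hmaps : MapsTo f (Ioo 0 1) (Ioo 0 1) := fun s hs => by
    have h1 : 0 < 1 + s := by linarith [hs.1]
    exact ⟨div_pos (by linarith [hs.2]) h1, (div_lt_one h1).2 (by linarith [hs.1])⟩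
  have hinv : ∀ s ∈ Ioo (0 : ℝ) 1, f (f s) = s := fun s hs => by
    have h1 : 1 + s ≠ 0 := by linarith [hs.1]
    simp only [hf]
    field_simp
    ring
  have himage : f '' Ioo 0 1 = Ioo 0 1 :=
    Subset.antisymm hmaps.image_subset fun s hs => ⟨f s, hmaps hs, hinv s hs⟩
  have hinj : InjOn f (Ioo 0 1) := LeftInvOn.injOn hinv
  have hderiv : ∀ s ∈ Ioo (0 : ℝ) 1, HasDerivWithinAt f (-2 / (1 + s) ^ 2) (Ioo 0 1) s := by
    intro s hs
    have h1 : 1 + s ≠ 0 := by linarith [hs.1]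
    have h := ((hasDerivAt_id s).const_sub 1).div ((hasDerivAt_id s).const_add 1) h1
    convert! h.hasDerivWithinAt using 1
    simp only [id]
    ring
  have key := lintegral_image_eq_lintegral_abs_deriv_mul measurableSet_Ioo hderiv hinj fun t =>
    ENNReal.ofReal ((Real.log (1 + t) - Real.log (1 - t)) ^ 2 / (2 * (1 + t)))
  rw [himage] at key
  rw [key]
  refine setLIntegral_congr_fun measurableSet_Ioo fun s hs => ?_
  have h1 : 0 < 1 + s := by linarith [hs.1]
  have hs0 := hs.1
  have e1 : 1 + f s = 2 / (1 + s) := by simp only [hf]; field_simp; ring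
  have e2 : 1 - f s = s * (2 / (1 + s)) := by simp only [hf]; field_simp; ring
  rw [← ENNReal.ofReal_mul (abs_nonneg _), e1, e2, Real.log_mul hs0.ne' (by positivity),
    abs_div, abs_neg, abs_two, abs_of_pos (by positivity : 0 < (1 + s) ^ 2)]
  congr 1
  field_simp
  ring

lemma hasSum_evenOddSum :
    HasSum (fun m : ℕ => 4 * evenOddSum m * (1 / (2 * (m : ℝ) + 1) - 1 / (2 * (m : ℝ) + 2)))
      (3 / 4 * ∑' n : ℕ, 1 / ((n : ℝ) + 1) ^ 3) := by
  set c := 3 / 4 * ∑' n : ℕ, 1 / ((n : ℝ) + 1) ^ 3 with hc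
  have hc0 : 0 ≤ c := mul_nonneg (by norm_num) (tsum_nonneg fun n => by positivity)
  set g : ℕ → ℝ :=
    fun m => 4 * evenOddSum (m + 1) * (1 / (2 * (m : ℝ) + 3) - 1 / (2 * (m : ℝ) + 4)) with hg
  have hg0 : ∀ m, 0 ≤ g m := fun m => by
    refine mul_nonneg (mul_nonneg (by norm_num) (evenOddSum_nonneg _)) (sub_nonneg.2 ?_)
    gcongr
    norm_num
  have hterm : ∀ m, ENNReal.ofReal (g m) = ∫⁻ t in Ioo (0 : ℝ) 1,
      ENNReal.ofReal (4 * evenOddSum (m + 1)) *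
        ENNReal.ofReal (t ^ (2 * m + 2) * (1 - t)) := fun m => by
    have hA : 0 ≤ 4 * evenOddSum (m + 1) := mul_nonneg (by norm_num) (evenOddSum_nonneg _)
    rw [lintegral_const_mul _ (by fun_prop), lintegral_pow_mul_one_sub, ← ENNReal.ofReal_mul hA]
    simp only [hg]
    push_cast
    congr 3 <;> ring
  have htsum : ∑' m, ENNReal.ofReal (g m) = ENNReal.ofReal c := by
    rw [tsum_congr hterm, ← lintegral_tsum fun n => by fun_prop, hc, ← lintegral_log_sq_div,
      ← lintegral_artanh_sq_div]
    refine setLIntegral_congr_fun measurableSet_Ioo fun t ht => ?_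
    have hsum := hasSum_evenOddSum_mul_pow ht.1 ht.2
    have hnn : ∀ m : ℕ, 0 ≤ 4 * evenOddSum (m + 1) * (t ^ (2 * m + 2) * (1 - t)) := fun m =>
      mul_nonneg (mul_nonneg (by norm_num) (evenOddSum_nonneg _))
        (mul_nonneg (pow_nonneg ht.1.le _) (sub_nonneg.2 ht.2.le))
    rw [← hsum.tsum_eq, ENNReal.ofReal_tsum_of_nonneg hnn hsum.summable]
    refine tsum_congr fun m => (ENNReal.ofReal_mul ?_).symm
    exact mul_nonneg (by norm_num) (evenOddSum_nonneg _)
  have hgsum : HasSum g c := by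
    have h := ENNReal.hasSum_toReal (f := fun m => ENNReal.ofReal (g m))
      (by rw [htsum]; exact ENNReal.ofReal_ne_top)
    rw [← ENNReal.tsum_toReal_eq fun _ => ENNReal.ofReal_ne_top, htsum,
      ENNReal.toReal_ofReal hc0] at h
    simpa only [ENNReal.toReal_ofReal (hg0 _)] using h
  have h := (hasSum_nat_add_iff (f := fun m : ℕ => 4 * evenOddSum m *
    (1 / (2 * (m : ℝ) + 1) - 1 / (2 * (m : ℝ) + 2))) 1).1 (show HasSum _ c by
      convert! hgsum using 2 with m
      simp only [hg]
      push_cast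
      congr 3 <;> ring)
  simpa [evenOddSum] using h

lemma sum_neg_one_pow_sub_one_div (k : ℕ) :
    ∑ n ∈ Finset.Ico 1 (2 * k + 2), ((-1 : ℝ) ^ n - 1) / n = -2 * oddHarmonic (k + 1) := by
  induction k with
  | zero => norm_num [oddHarmonic]
  | succ k ih =>
    rw [show 2 * (k + 1) + 2 = 2 * k + 2 + 1 + 1 by ring, Finset.sum_Ico_succ_top (by lia),
      Finset.sum_Ico_succ_top (by lia), ih, oddHarmonic, oddHarmonic,
      Finset.sum_range_succ _ (k + 1)]
    simp only [pow_succ, pow_mul]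
    push_cast
    ring

/-- The part of the triple sum over `n₂ > n₃` below a fixed `n₁ = n`. -/
noncomputable def innerSum (n : ℕ) : ℝ :=
  ∑ n₂ ∈ Finset.Ico 1 n, (1 + (-1 : ℝ) ^ n₂) / n₂ *
    ∑ n₃ ∈ Finset.Ico 1 n₂, ((-1 : ℝ) ^ n₃ - 1) / n₃

lemma innerSum_even (m : ℕ) : innerSum (2 * m + 2) = innerSum (2 * m + 1) := by
  rw [innerSum, Finset.sum_Ico_succ_top (by lia), ← innerSum]
  simp [pow_succ, pow_mul]

lemma innerSum_odd (m : ℕ) : innerSum (2 * m + 1) = -4 * evenOddSum m := by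
  induction m with
  | zero => simp [innerSum, evenOddSum]
  | succ m ih =>
    rw [show 2 * (m + 1) + 1 = 2 * m + 2 + 1 by ring, innerSum,
      Finset.sum_Ico_succ_top (by lia), ← innerSum, innerSum_even, ih,
      sum_neg_one_pow_sub_one_div, evenOddSum_succ]
    simp only [pow_succ, pow_mul]
    push_cast
    field_simp
    norm_num
    ring

lemma triple_sum_eq_sum_innerSum (N : ℕ) :
    ∑ n₁ ∈ Finset.Icc 1 N, ∑ n₂ ∈ Finset.Ico 1 n₁, ∑ n₃ ∈ Finset.Ico 1 n₂,
        (((-1 : ℝ) ^ (n₁ + n₂ + n₃) + (-1) ^ (n₁ + n₃) - (-1) ^ n₁ - (-1) ^ (n₁ + n₂)) /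
          ((n₁ : ℝ) * n₂ * n₃)) =
      ∑ n ∈ Finset.range N, (-1 : ℝ) ^ (n + 1) / ((n : ℝ) + 1) * innerSum (n + 1) := by
  rw [← Finset.Ico_add_one_right_eq_Icc, Finset.sum_Ico_eq_sum_range, Nat.add_sub_cancel]
  refine Finset.sum_congr rfl fun n _ => ?_
  rw [innerSum, add_comm 1 n, Finset.mul_sum]
  refine Finset.sum_congr rfl fun n₂ _ => ?_
  rw [Finset.mul_sum, Finset.mul_sum]
  refine Finset.sum_congr rfl fun n₃ _ => ?_
  rw [div_mul_div_comm, div_mul_div_comm]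
  push_cast
  ring

lemma sum_range_two_mul (M : ℕ) :
    ∑ n ∈ Finset.range (2 * M), (-1 : ℝ) ^ (n + 1) / ((n : ℝ) + 1) * innerSum (n + 1) =
      ∑ m ∈ Finset.range M,
        4 * evenOddSum m * (1 / (2 * (m : ℝ) + 1) - 1 / (2 * (m : ℝ) + 2)) := by
  induction M with
  | zero => simp
  | succ M ih =>
    rw [show 2 * (M + 1) = 2 * M + 1 + 1 by ring, Finset.sum_range_succ, Finset.sum_range_succ,
      ih, Finset.sum_range_succ, innerSum_even, innerSum_odd]
    simp only [pow_succ, pow_mul]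
    push_cast
    ring

/-- The limit as `N → ∞` of
`Σ_{N ≥ n₁ > n₂ > n₃ ≥ 1} ((−1)^{n₁+n₂+n₃} + (−1)^{n₁+n₃} − (−1)^{n₁} − (−1)^{n₁+n₂})/(n₁n₂n₃)`
exists and equals `(3/4) Σ_{n ≥ 1} n^{−3}`; equivalently
`ζ(1̄,1̄,1̄) + ζ(1̄,1,1̄) − ζ(1̄,1,1) − ζ(1̄,1̄,1) = (3/4) ζ(3)`, i.e. the
shuffle-regularized symmetric multiple T-value `T_⧢^𝒮(1,1,1) = (3/16)ζ(3)`. -/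
theorem symmetric_T_one_one_one :
    Tendsto
      (fun N : ℕ => ∑ n₁ ∈ Finset.Icc 1 N, ∑ n₂ ∈ Finset.Ico 1 n₁, ∑ n₃ ∈ Finset.Ico 1 n₂,
        (((-1 : ℝ) ^ (n₁ + n₂ + n₃) + (-1) ^ (n₁ + n₃) - (-1) ^ n₁ - (-1) ^ (n₁ + n₂)) /
          ((n₁ : ℝ) * n₂ * n₃)))
      atTop
      (nhds ((3 / 4) * ∑' n : ℕ, 1 / ((n : ℝ) + 1) ^ 3)) := by
  simp_rw [triple_sum_eq_sum_innerSum]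
  have hdiv : Tendsto (fun N : ℕ => N / 2) atTop atTop :=
    Nat.tendsto_div_const_atTop two_ne_zero
  have hmain := hasSum_evenOddSum.tendsto_sum_nat.comp hdiv
  have hrem : Tendsto (fun N : ℕ => ((N % 2 : ℕ) : ℝ) *
      (4 * evenOddSum (N / 2) / (2 * ((N / 2 : ℕ) : ℝ) + 1))) atTop (nhds 0) := by
    have hnn : ∀ m : ℕ, 0 ≤ 4 * evenOddSum m / (2 * (m : ℝ) + 1) := fun m =>
      div_nonneg (mul_nonneg (by norm_num) (evenOddSum_nonneg m)) (by positivity)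
    refine squeeze_zero (fun N => mul_nonneg (Nat.cast_nonneg _) (hnn _)) (fun N => ?_)
      (tendsto_evenOddSum_div.comp hdiv)
    refine mul_le_of_le_one_left (hnn _) ?_
    exact_mod_cast Nat.lt_succ_iff.1 (Nat.mod_lt N two_pos)
  have h := hmain.add hrem
  rw [add_zero] at h
  refine h.congr fun N => ?_
  simp only [Function.comp]
  rw [← sum_range_two_mul]
  obtain ⟨M, rfl | rfl⟩ := Nat.even_or_odd' N
  · simp
  · rw [show (2 * M + 1) / 2 = M by lia, show (2 * M + 1) % 2 = 1 by lia,
      Finset.sum_range_succ, innerSum_odd]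
    simp only [pow_succ, pow_mul]
    push_cast
    ring
end

section
/- Let s be an even positive integer and d ≥ 1. Then there exists N such that for every prime p > N, ζ_p((s,…,s); (−1,…,−1)) = 0 in ℤ/pℤ (the entry s and the sign −1 each repeated d times); that is, the finite Euler sum ζ_𝒜({s̄}^d) vanishes. -/
open scoped Classical

/-- Finite Euler sum `ζ_p(s;σ)`, with entries `(s_j, σ_j)`: the sum over
`p > n₁ > ⋯ > n_d > 0` of `∏ σ_j^{n_j} n_j^{−s_j}` in `ℤ/pℤ`. -/
noncomputable def ZsumP (p : ℕ) (l : List (ℕ × ℤ)) : ZMod p :=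
  ∑ n : Fin l.length → Fin p,
    if (∀ j, 0 < (n j : ℕ)) ∧ (∀ i j : Fin l.length, i < j → (n j : ℕ) < (n i : ℕ))
    then ∏ j, ((l.get j).2 : ZMod p) ^ (n j : ℕ) * (((n j : ℕ) : ZMod p) ^ (l.get j).1)⁻¹
    else 0

/-- Summing over strictly decreasing tuples is summing over subsets. -/
lemma sum_strictAnti_eq_sum_powersetCard {α R : Type*} [LinearOrder α] [Fintype α]
    [CommSemiring R] (d : ℕ) (f : α → R) :
    (∑ n : Fin d → α with StrictAnti n, ∏ j, f (n j)) =
      ∑ t ∈ Finset.univ.powersetCard d, ∏ i ∈ t, f i := by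
  refine Finset.sum_bij' (fun n _ => Finset.univ.image n)
    (fun t ht => fun j => t.orderEmbOfFin (Finset.mem_powersetCard.1 ht).2 j.rev) ?_ ?_ ?_ ?_ ?_
  · intro n hn
    have hn : StrictAnti n := by simpa using hn
    simp [Finset.mem_powersetCard, Finset.card_image_of_injective _ hn.injective]
  · intro t ht
    simp only [Finset.mem_filter, Finset.mem_univ, true_and]
    intro i j hij
    simpa using hij
  · intro n hn
    have hn : StrictAnti n := by simpa using hn
    have hcard : (Finset.univ.image n).card = d := by
      simp [Finset.card_image_of_injective _ hn.injective]
    have h := Finset.orderEmbOfFin_unique (f := fun j => n j.rev) hcard (by simp)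
      (fun i j hij => hn (by simpa using hij))
    funext j
    simpa using (congrFun h j.rev).symm
  · intro t ht
    have hcard := (Finset.mem_powersetCard.1 ht).2
    ext x
    have h := Set.ext_iff.1 (Finset.range_orderEmbOfFin t hcard) x
    simp only [Set.mem_range, Finset.mem_coe] at h
    simp only [Finset.mem_image, Finset.mem_univ, true_and]
    rw [← h]
    exact ⟨fun ⟨a, ha⟩ => ⟨a.rev, ha⟩, fun ⟨a, ha⟩ => ⟨a.rev, by simpa using ha⟩⟩
  · intro n hn
    have hn : StrictAnti n := by simpa using hn
    rw [Finset.prod_image hn.injective.injOn]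

/-- If the power sums of degrees `1, …, d` vanish and `d` is invertible, then so does the
elementary symmetric sum of degree `d`. -/
lemma sum_powersetCard_prod_eq_zero {σ K : Type*} [Fintype σ] [Field K] (x : σ → K) (d : ℕ)
    (hd : (d : K) ≠ 0) (hx : ∀ k, 0 < k → k ≤ d → ∑ i, x i ^ k = 0) :
    ∑ t ∈ Finset.univ.powersetCard d, ∏ i ∈ t, x i = 0 := by
  have h := congrArg (MvPolynomial.aeval x) (MvPolynomial.mul_esymm_eq_sum σ K d)
  have hz : ∑ a ∈ Finset.HasAntidiagonal.antidiagonal d with a.1 < d,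
      (-1 : K) ^ a.1 * MvPolynomial.aeval x (MvPolynomial.esymm σ K a.1) *
        MvPolynomial.aeval x (MvPolynomial.psum σ K a.2) = 0 := by
    refine Finset.sum_eq_zero fun a ha => ?_
    simp only [Finset.mem_filter, Finset.HasAntidiagonal.mem_antidiagonal] at ha
    have h0 : MvPolynomial.aeval x (MvPolynomial.psum σ K a.2) = 0 := by
      simpa [MvPolynomial.psum] using hx a.2 (by omega) (by omega)
    rw [h0, mul_zero]
  simp only [map_mul, map_sum, map_pow, map_neg, map_one, map_natCast] at h
  rw [hz, mul_zero] at h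
  have hesymm := (mul_eq_zero.1 h).resolve_left hd
  simpa [MvPolynomial.esymm] using hesymm

/-- The terms `(-1) ^ n / n ^ s` of the sum, with `n` in `ℤ/pℤ` represented in `[0, p)`. -/
noncomputable def altTerm (p s : ℕ) (x : ZMod p) : ZMod p := (-1) ^ x.val * (x ^ s)⁻¹

lemma altTerm_neg {p s : ℕ} [Fact p.Prime] (hp : Odd p) (hs0 : 0 < s) (hs : Even s)
    (x : ZMod p) : altTerm p s (-x) = -altTerm p s x := by
  unfold altTerm
  by_cases hx : x = 0
  · simp [hx, hs0.ne']
  · have : NeZero x := ⟨hx⟩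
    have hv : (-1 : ZMod p) ^ (-x).val = -(-1) ^ x.val := by
      have hlt := x.val_lt
      rw [ZMod.val_neg_of_ne_zero]
      rcases Nat.even_or_odd x.val with h | h
      · rw [(Nat.Odd.sub_even hlt.le hp h).neg_one_pow, h.neg_one_pow]
      · rw [(Nat.Odd.sub_odd hp h).neg_one_pow, h.neg_one_pow, neg_neg]
    rw [hv, hs.neg_pow, neg_mul]

lemma sum_altTerm_pow {p s k : ℕ} [Fact p.Prime] (hp : Odd p) (hs0 : 0 < s) (hs : Even s)
    (hk : s * k < p - 1) : ∑ x : ZMod p, altTerm p s x ^ k = 0 := by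
  rcases Nat.even_or_odd k with h | h
  · have hterm : ∀ x : ZMod p, altTerm p s x ^ k = x⁻¹ ^ (s * k) := fun x => by
      rw [altTerm, mul_pow, ← pow_mul, (h.mul_left _).neg_one_pow, one_mul, inv_pow, inv_pow,
        pow_mul]
    simp_rw [hterm]
    have hinv : ∑ x : ZMod p, x⁻¹ ^ (s * k) = ∑ x : ZMod p, x ^ (s * k) :=
      Equiv.sum_comp (Equiv.inv (ZMod p)) (fun x => x ^ (s * k))
    rw [hinv]
    exact FiniteField.sum_pow_lt_card_sub_one (ZMod p) (s * k) (by rwa [ZMod.card])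
  · have hneg : ∑ x : ZMod p, altTerm p s x ^ k = -∑ x : ZMod p, altTerm p s x ^ k := by
      conv_lhs => rw [← Equiv.sum_comp (Equiv.neg (ZMod p))]
      simp only [Equiv.neg_apply, altTerm_neg hp hs0 hs, h.neg_pow, Finset.sum_neg_distrib]
    have : NeZero (2 : ZMod p) := ⟨by
      intro h2
      have hdvd := (ZMod.natCast_eq_zero_iff 2 p).1 (by exact_mod_cast h2)
      have := (Nat.prime_dvd_prime_iff_eq Fact.out Nat.prime_two).1 hdvd
      subst this
      exact absurd hp (by decide)⟩
    have h2 : (2 : ZMod p) * ∑ x : ZMod p, altTerm p s x ^ k = 0 := by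
      linear_combination hneg
    exact (mul_eq_zero.1 h2).resolve_left (NeZero.ne _)

/-- The sum `ζ_p({s̄}^d)` is an elementary symmetric sum. -/
lemma zsumP_eq_sum_powersetCard {p s : ℕ} [Fact p.Prime] (hs0 : 0 < s) (l : List (ℕ × ℤ))
    (hl : ∀ a ∈ l, a = (s, -1)) :
    ZsumP p l = ∑ t ∈ Finset.univ.powersetCard l.length,
      ∏ n ∈ t, altTerm p s ((n : Fin p) : ℕ) := by
  rw [← sum_strictAnti_eq_sum_powersetCard, Finset.sum_filter, ZsumP]
  refine Finset.sum_congr rfl fun n _ => ?_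
  have hterm : ∀ j, ((l.get j).2 : ZMod p) ^ (n j : ℕ) * (((n j : ℕ) : ZMod p) ^ (l.get j).1)⁻¹ =
      altTerm p s (n j : ℕ) := fun j => by
    rw [hl _ (l.get_mem j), altTerm, ZMod.val_natCast_of_lt (n j).isLt]
    simp
  simp_rw [hterm]
  have hanti : StrictAnti n ↔ ∀ i j : Fin l.length, i < j → (n j : ℕ) < (n i : ℕ) :=
    ⟨fun h i j hij => h hij, fun h i j hij => h i j hij⟩
  by_cases hpos : ∀ j, 0 < (n j : ℕ)
  · simp only [hpos, implies_true, true_and, hanti]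
  · rw [if_neg fun h => hpos h.1]
    push Not at hpos
    obtain ⟨j, hj⟩ := hpos
    have h0 : ∏ j, altTerm p s (n j : ℕ) = 0 := by
      refine Finset.prod_eq_zero (Finset.mem_univ j) ?_
      rw [Nat.le_zero.1 hj]
      simp [altTerm, hs0.ne']
    rw [h0, ite_self]

/-- For `s` even positive and `d ≥ 1`, the finite Euler sum `ζ_𝒜({s̄}^d)`
vanishes: there is `N` with `ζ_p({s̄}^d) = 0` for all primes `p > N`. -/
theorem homogeneous_even_bar_vanishes (s d : ℕ) (hs0 : 0 < s) (hs : Even s)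
    (hd : 1 ≤ d) :
    ∃ N : ℕ, ∀ p : ℕ, N < p → p.Prime →
      ZsumP p (List.replicate d (s, (-1 : ℤ))) = 0 := by
  refine ⟨s * d + 2, fun p hN hp => ?_⟩
  have : Fact p.Prime := ⟨hp⟩
  have hodd : Odd p := hp.odd_of_ne_two (by omega)
  have hds : d ≤ s * d := Nat.le_mul_of_pos_left d hs0
  rw [zsumP_eq_sum_powersetCard hs0 _ fun a ha => List.eq_of_mem_replicate ha,
    List.length_replicate]
  refine sum_powersetCard_prod_eq_zero _ d (fun h => ?_) fun k _ hkd => ?_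
  · have := Nat.le_of_dvd hd ((ZMod.natCast_eq_zero_iff d p).1 h)
    omega
  · have hsk : s * k ≤ s * d := Nat.mul_le_mul_left s hkd
    rw [← sum_altTerm_pow hodd hs0 hs (k := k) (by omega)]
    refine Fintype.sum_equiv (ZMod.finEquiv p).toEquiv _ _ fun n => ?_
    congr 2
    obtain _ | m := p
    · exact n.elim0
    · exact Fin.cast_val_eq_self n
end

section
/- Reversal relation for finite alternating multiple T-values: let d be an even positive integer, s = (s_1,…,s_d) a tuple of positive integers, and σ = (σ_1,…,σ_d) ∈ {±1}^d. Then for every odd prime p > d, T_p(s_d,…,s_1; σ_d,…,σ_1) = (σ_1·σ_2⋯σ_d)^{(p−1−d)/2} · (−1)^{s_1+⋯+s_d} · T_p(s_1,…,s_d; σ_1,…,σ_d) in ℤ/pℤ (note that (p−1−d)/2 is a non-negative integer since p is odd, d is even and p > d). -/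
open scoped Classical

/-- Finite alternating multiple T-sum `T_p(s;σ)`, with entries `(s_j, σ_j)`:
the sum over `p > n₁ > ⋯ > n_d > 0` with `n_j ≡ d−j+1 (mod 2)` (1-based) of
`∏ σ_j^{(n_j−d+j−1)/2} n_j^{−s_j}` in `ℤ/pℤ` (written 0-based below). -/
noncomputable def TaltP (p : ℕ) (l : List (ℕ × ℤ)) : ZMod p :=
  ∑ n : Fin l.length → Fin p,
    if (∀ j, 0 < (n j : ℕ)) ∧ (∀ i j : Fin l.length, i < j → (n j : ℕ) < (n i : ℕ)) ∧
       (∀ j : Fin l.length, (n j : ℕ) % 2 = (l.length - (j : ℕ)) % 2)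
    then ∏ j, ((l.get j).2 : ZMod p) ^ (((n j : ℕ) + (j : ℕ) - l.length) / 2) *
              (((n j : ℕ) : ZMod p) ^ (l.get j).1)⁻¹
    else 0

/-- The index set of the finite multiple `T`-sum of depth `d`. -/
def IsTIndex (p d : ℕ) (n : Fin d → Fin p) : Prop :=
  (∀ j, 0 < (n j : ℕ)) ∧ (∀ i j : Fin d, i < j → (n j : ℕ) < (n i : ℕ)) ∧
    (∀ j : Fin d, (n j : ℕ) % 2 = (d - (j : ℕ)) % 2)

/-- `TaltP` with the list of entries replaced by a function on `Fin d`. -/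
noncomputable def altTSum (p d : ℕ) (f : Fin d → ℕ × ℤ) : ZMod p :=
  ∑ n : Fin d → Fin p,
    if IsTIndex p d n
    then ∏ j, ((f j).2 : ZMod p) ^ (((n j : ℕ) + (j : ℕ) - d) / 2) *
              (((n j : ℕ) : ZMod p) ^ (f j).1)⁻¹
    else 0

theorem TaltP_eq_altTSum (p d : ℕ) (l : List (ℕ × ℤ)) (h : l.length = d) :
    TaltP p l = altTSum p d (fun j => l.get (j.cast h.symm)) := by
  subst h
  exact Finset.sum_congr rfl fun n _ => if_congr Iff.rfl rfl rfl

/-- The involution `(n₁, …, n_d) ↦ (p - n_d, …, p - n₁)`, with `p - 0` read as `0`. -/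
def reflectEquiv (p d : ℕ) [NeZero p] : (Fin d → Fin p) ≃ (Fin d → Fin p) :=
  Fin.revPerm.arrowCongr (Equiv.neg (Fin p))

theorem reflectEquiv_apply (p d : ℕ) [NeZero p] (n : Fin d → Fin p) (j : Fin d) :
    reflectEquiv p d n j = -(n j.rev) := rfl

theorem reflectEquiv_reflectEquiv (p d : ℕ) [NeZero p] (n : Fin d → Fin p) :
    reflectEquiv p d (reflectEquiv p d n) = n := by
  funext j
  simp [reflectEquiv_apply]

theorem Fin.val_neg_of_pos {p : ℕ} [NeZero p] (a : Fin p) (ha : 0 < (a : ℕ)) :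
    ((-a : Fin p) : ℕ) = p - a := by
  rw [Fin.val_neg, if_neg]
  rintro rfl
  simp at ha

namespace IsTIndex

variable {p d : ℕ} {n : Fin d → Fin p}

theorem le_add (h : IsTIndex p d n) (j : Fin d) : d ≤ (n j : ℕ) + j := by
  obtain ⟨j, hj⟩ := j
  induction hk : d - j generalizing j with
  | zero => omega
  | succ k ih =>
    have h0 := h.1 ⟨j, hj⟩
    by_cases hj' : j + 1 < d
    · have h1 := ih (j + 1) hj' (by omega)
      have h2 := h.2.1 ⟨j, hj⟩ ⟨j + 1, hj'⟩ (by simp)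
      simp only at h1 ⊢
      omega
    · simp only
      omega

theorem reflect [NeZero p] (hd : Even d) (hp : Odd p) (h : IsTIndex p d n) :
    IsTIndex p d (reflectEquiv p d n) := by
  have hval (j : Fin d) : (reflectEquiv p d n j : ℕ) = p - n j.rev :=
    Fin.val_neg_of_pos _ (h.1 _)
  refine ⟨fun j => ?_, fun i j hij => ?_, fun j => ?_⟩
  · rw [hval]
    have := (n j.rev).isLt
    omega
  · rw [hval, hval]
    have := h.2.1 j.rev i.rev (Fin.rev_lt_rev.2 hij)
    have := (n j.rev).isLt
    omega
  · rw [hval]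
    have h1 := h.2.2 j.rev
    rw [Fin.val_rev] at h1
    have := (n j.rev).isLt
    have := j.isLt
    obtain ⟨a, rfl⟩ := hd
    obtain ⟨b, rfl⟩ := hp
    omega

theorem reflect_iff [NeZero p] (hd : Even d) (hp : Odd p) :
    IsTIndex p d (reflectEquiv p d n) ↔ IsTIndex p d n :=
  ⟨fun h => reflectEquiv_reflectEquiv p d n ▸ h.reflect hd hp, reflect hd hp⟩

end IsTIndex

theorem pow_eq_pow_of_even_add {R : Type*} [CommRing R] {x : R} (hx : x = 1 ∨ x = -1)
    {a b : ℕ} (h : Even (a + b)) : x ^ a = x ^ b := by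
  rcases hx with rfl | rfl
  · simp
  · exact neg_one_pow_congr (Nat.even_add.1 h)

theorem altTSum_rev (p d : ℕ) (f : Fin d → ℕ × ℤ) (hf : ∀ j, (f j).2 = 1 ∨ (f j).2 = -1)
    (hd : Even d) (hp : p.Prime) (hp2 : p ≠ 2) (hpd : d < p) :
    altTSum p d (fun j => f j.rev) =
      ((∏ j, (f j).2 : ℤ) : ZMod p) ^ ((p - 1 - d) / 2) *
        (-1 : ZMod p) ^ (∑ j, (f j).1) * altTSum p d f := by
  have : Fact p.Prime := ⟨hp⟩
  have hodd : Odd p := hp.odd_of_ne_two hp2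
  unfold altTSum
  rw [← (reflectEquiv p d).sum_comp, Finset.mul_sum]
  refine Finset.sum_congr rfl fun n _ => ?_
  rw [if_congr (IsTIndex.reflect_iff hd hodd) rfl rfl]
  split_ifs with h
  swap
  · simp
  rw [← Equiv.prod_comp Fin.revPerm, Int.cast_prod, ← Finset.prod_pow, ← Finset.prod_pow_eq_pow_sum,
    ← Finset.prod_mul_distrib, ← Finset.prod_mul_distrib]
  refine Finset.prod_congr rfl fun j _ => ?_
  have hval : (reflectEquiv p d n j.rev : ℕ) = p - n j := by
    rw [reflectEquiv_apply, Fin.rev_rev, Fin.val_neg_of_pos _ (h.1 _)]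
  have hlt := (n j).isLt
  have hcast : ((p - n j : ℕ) : ZMod p) = -1 * ((n j : ℕ) : ZMod p) := by
    rw [Nat.cast_sub hlt.le]
    simp
  have hle := h.le_add j
  have hle' := (h.reflect hd hodd).le_add j.rev
  have hpar := h.2.2 j
  have hj := j.isLt
  have hsgn : (((f j).2 : ℤ) : ZMod p) = 1 ∨ (((f j).2 : ℤ) : ZMod p) = -1 := by
    rcases hf j with h | h <;> simp [h]
  have hpow : (((f j).2 : ℤ) : ZMod p) ^ ((p - n j + (d - (j + 1)) - d) / 2) =
      (((f j).2 : ℤ) : ZMod p) ^ ((p - 1 - d) / 2 + ((n j : ℕ) + j - d) / 2) := by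
    refine pow_eq_pow_of_even_add hsgn ?_
    rw [hval, Fin.val_rev] at hle'
    obtain ⟨a, rfl⟩ := hd
    obtain ⟨b, rfl⟩ := hodd
    rw [Nat.even_iff]
    omega
  simp only [Fin.revPerm_apply, Fin.rev_rev, hval, Fin.val_rev, hcast, hpow, mul_pow, mul_inv,
    pow_add, inv_neg_one, ← inv_pow]
  ring

/-- Reversal relation for finite alternating multiple T-values: for even depth
`d > 0`, `s ∈ ℕ₊^d`, signs `σ ∈ {±1}^d`, and every odd prime `p > d`,
`T_p(←s; ←σ) = (σ₁⋯σ_d)^{(p−1−d)/2} (−1)^{|s|} T_p(s; σ)` in `ℤ/pℤ`. -/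
theorem reversal_FAMTV (l : List (ℕ × ℤ))
    (hpos : ∀ x ∈ l, 0 < x.1) (hsgn : ∀ x ∈ l, x.2 = 1 ∨ x.2 = -1)
    (hne : l ≠ []) (heven : Even l.length)
    (p : ℕ) (hp : p.Prime) (hp2 : p ≠ 2) (hpd : l.length < p) :
    TaltP p l.reverse
      = (((l.map Prod.snd).prod : ℤ) : ZMod p) ^ ((p - 1 - l.length) / 2) *
          (-1 : ZMod p) ^ (l.map Prod.fst).sum * TaltP p l := by
  have hrev : (fun j : Fin l.length => l.reverse.get (j.cast l.length_reverse.symm)) =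
      fun j => l.get j.rev := by
    funext j
    simp only [List.get_eq_getElem, Fin.val_cast, List.getElem_reverse, Fin.val_rev]
    congr 1
    omega
  have hsum : (l.map Prod.fst).sum = ∑ j, (l.get j).1 := by
    simp [← Fin.sum_univ_fun_getElem]
  have hprod : (l.map Prod.snd).prod = ∏ j, (l.get j).2 := by
    simp [← Fin.prod_univ_fun_getElem]
  rw [TaltP_eq_altTSum p l.length l.reverse l.length_reverse, hrev,
    altTSum_rev p l.length l.get (fun j => hsgn _ (l.get_mem j)) heven hp hp2 hpd, hsum, hprod,
    TaltP_eq_altTSum p l.length l rfl]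
  rfl
end

section
/- For every odd prime p, Σ_{0 < k < p, k even} (−1)^{k/2} · k^{−1} = −q_p/2 in ℤ/pℤ; that is, the finite alternating value S_𝒜(1̄) equals −𝚚₂/2. -/
/-- The Fermat quotient `q_p = (2^{p−1} − 1)/p`, reduced mod `p`. -/
def qF (p : ℕ) : ZMod p := (((2 ^ (p - 1) - 1) / p : ℕ) : ZMod p)

/-- The Fermat quotient at an odd prime is half of a row of normalized binomial coefficients. -/
theorem two_pow_sub_one_div_eq_sum_choose_div {p m : ℕ} (hp : p.Prime) (hm : p = 2 * m + 1) :
    (2 ^ (p - 1) - 1) / p = ∑ i ∈ Finset.range m, p.choose (i + 1) / p := by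
  have h := Nat.sum_range_choose_halfway m
  rw [Finset.sum_range_succ', ← hm, Nat.choose_zero_right] at h
  have h4 : 2 ^ (p - 1) = 4 ^ m := by
    rw [hm, Nat.add_sub_cancel, pow_mul]
    norm_num
  have hs : ∑ i ∈ Finset.range m, p.choose (i + 1)
      = p * ∑ i ∈ Finset.range m, p.choose (i + 1) / p := by
    rw [Finset.mul_sum]
    refine Finset.sum_congr rfl fun i hi => ?_
    have hi' := Finset.mem_range.1 hi
    exact (Nat.mul_div_cancel' (hp.dvd_choose_self (by omega) (by omega))).symm
  rw [h4, ← h, Nat.add_sub_cancel, hs, Nat.mul_div_cancel_left _ hp.pos]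

theorem ZMod.choose_prime_sub_one {p : ℕ} (hp : p.Prime) {k : ℕ} (hk : k < p) :
    (((p - 1).choose k : ℕ) : ZMod p) = (-1) ^ k := by
  induction k with
  | zero => simp
  | succ k ih =>
    have h : ((p.choose (k + 1) : ℕ) : ZMod p) = 0 :=
      (ZMod.natCast_eq_zero_iff _ _).2 (hp.dvd_choose_self (by omega) hk)
    rw [Nat.choose_eq_choose_pred_add hp.pos k.succ_pos, Nat.succ_sub_one, Nat.cast_add,
      ih (by omega)] at h
    rw [pow_succ]
    linear_combination h

theorem ZMod.choose_prime_div_self {p : ℕ} (hp : p.Prime) {k : ℕ} (hk : k + 1 < p) :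
    ((p.choose (k + 1) / p : ℕ) : ZMod p) = (-1) ^ k * ((k + 1 : ℕ) : ZMod p)⁻¹ := by
  have := Fact.mk hp
  have hne : ((k + 1 : ℕ) : ZMod p) ≠ 0 := by
    rw [Ne, ZMod.natCast_eq_zero_iff]
    exact fun h => absurd (Nat.le_of_dvd k.succ_pos h) (by omega)
  rw [eq_mul_inv_iff_mul_eq₀ hne, ← ZMod.choose_prime_sub_one hp (by omega : k < p),
    ← Nat.cast_mul]
  congr 1
  obtain ⟨c, hc⟩ := hp.dvd_choose_self k.succ_ne_zero hk
  have h := Nat.add_one_mul_choose_eq (p - 1) k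
  rw [Nat.sub_add_cancel hp.one_le, hc, mul_assoc] at h
  rw [hc, Nat.mul_div_cancel_left _ hp.pos]
  exact (Nat.eq_of_mul_eq_mul_left hp.pos h).symm

/-- For every odd prime `p`,
`Σ_{0 < k < p, k even} (−1)^{k/2} k⁻¹ = −q_p/2` in `ℤ/pℤ`;
i.e. the finite alternating value `S_𝒜(1̄) = −𝚚₂/2`. -/
theorem S_bar_one (p : ℕ) (hp : p.Prime) (hp2 : p ≠ 2) :
    ∑ k ∈ (Finset.Ioo 0 p).filter (fun k => k % 2 = 0),
        (-1 : ZMod p) ^ (k / 2) * (k : ZMod p)⁻¹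
      = -(qF p) * (2 : ZMod p)⁻¹ := by
  have := Fact.mk hp
  obtain ⟨m, hm⟩ := hp.odd_of_ne_two hp2
  rw [qF, two_pow_sub_one_div_eq_sum_choose_div hp hm, Nat.cast_sum, ← Finset.sum_neg_distrib,
    Finset.sum_mul]
  symm
  refine Finset.sum_nbij' (fun i => 2 * (i + 1)) (fun k => k / 2 - 1) ?_ ?_ ?_ ?_ ?_
  · intro i hi
    simp only [Finset.mem_range, Finset.mem_filter, Finset.mem_Ioo] at hi ⊢
    omega
  · intro k hk
    simp only [Finset.mem_range, Finset.mem_filter, Finset.mem_Ioo] at hk ⊢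
    omega
  · intro i hi
    omega
  · intro k hk
    simp only [Finset.mem_filter, Finset.mem_Ioo] at hk ⊢
    omega
  · intro i hi
    have hi' := Finset.mem_range.1 hi
    rw [ZMod.choose_prime_div_self hp (by omega), Nat.mul_div_cancel_left _ two_pos, Nat.cast_mul,
      mul_inv, pow_succ, Nat.cast_ofNat]
    ring
end

section
/- For every odd prime p, Σ_{0 < k < p, k odd} (−1)^{(k−1)/2} · k^{−1} = (−1)^{(p−1)/2} · q_p/2 in ℤ/pℤ; that is, the finite alternating value T_𝒜(1̄) equals ((−1)^{(p−1)/2} q_p(2)/2 mod p)_p. -/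
theorem sum_range_two_mul_eq_add_reflect {M : Type*} [AddCommMonoid M] (f : ℕ → M) (m : ℕ) :
    ∑ j ∈ Finset.range (2 * m), f j
      = ∑ j ∈ Finset.range m, f j + ∑ j ∈ Finset.range m, f (m + (m - 1 - j)) := by
  rw [Finset.sum_range_reflect (fun j => f (m + j)), two_mul, Finset.sum_range_add]

/-- For `p` prime and `j < p`, `C(p - 1, j) = (-1)^j` in `ℤ/pℤ`. -/
theorem cast_choose_prime_sub_one {p : ℕ} (hp : p.Prime) {j : ℕ} (hj : j < p) :
    ((p - 1).choose j : ZMod p) = (-1) ^ j := by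
  induction j with
  | zero => simp
  | succ j ih =>
    have hdvd : p ∣ p.choose (j + 1) := hp.dvd_choose_self (by omega) hj
    have hpascal : p.choose (j + 1) = (p - 1).choose j + (p - 1).choose (j + 1) := by
      conv_lhs => rw [show p = (p - 1) + 1 by omega]
      exact Nat.choose_succ_succ _ _
    rw [← ZMod.natCast_eq_zero_iff, hpascal, Nat.cast_add, ih (by omega)] at hdvd
    rw [pow_succ]
    linear_combination hdvd

theorem cast_choose_prime_div {p : ℕ} (hp : p.Prime) {j : ℕ} (hj : j + 1 < p) :
    ((p.choose (j + 1) / p : ℕ) : ZMod p) = (-1) ^ j * ((j + 1 : ℕ) : ZMod p)⁻¹ := by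
  have : Fact p.Prime := ⟨hp⟩
  obtain ⟨c, hc⟩ := hp.dvd_choose_self (k := j + 1) (by omega) hj
  have hne : ((j + 1 : ℕ) : ZMod p) ≠ 0 := by
    rw [Ne, ZMod.natCast_eq_zero_iff]
    exact Nat.not_dvd_of_pos_of_lt (by omega) hj
  have habs : p * (p - 1).choose j = p * (c * (j + 1)) := by
    have h := Nat.add_one_mul_choose_eq (p - 1) j
    rw [show p - 1 + 1 = p by have := hp.pos; omega, hc] at h
    rw [h, mul_assoc]
  rw [hc, Nat.mul_div_cancel_left _ hp.pos, eq_mul_inv_iff_mul_eq₀ hne,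
    ← cast_choose_prime_sub_one hp (by omega), Nat.eq_of_mul_eq_mul_left hp.pos habs, Nat.cast_mul]

/-- The alternating harmonic sum of length `p - 1` is `2 q_p` modulo `p`. -/
theorem sum_neg_one_pow_mul_inv {p : ℕ} (hp : p.Prime) (hp2 : p ≠ 2) :
    ∑ j ∈ Finset.range (p - 1), (-1 : ZMod p) ^ j * ((j + 1 : ℕ) : ZMod p)⁻¹ = 2 * qF p := by
  have : Fact p.Prime := ⟨hp⟩
  have hsum : ∑ j ∈ Finset.range (p - 1), p.choose (j + 1) + 2 = 2 * 2 ^ (p - 1) := by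
    have h := Nat.sum_range_choose p
    rw [Finset.sum_range_succ'] at h
    conv_lhs at h => rw [show Finset.range p = Finset.range (p - 1 + 1) by
      rw [Nat.sub_add_cancel hp.one_le]]
    rw [Finset.sum_range_succ, Nat.sub_add_cancel hp.one_le, Nat.choose_self,
      Nat.choose_zero_right] at h
    rw [← pow_succ', Nat.sub_add_cancel hp.one_le, ← h]
  have hdiv : p * ∑ j ∈ Finset.range (p - 1), p.choose (j + 1) / p
      = ∑ j ∈ Finset.range (p - 1), p.choose (j + 1) := by
    rw [Finset.mul_sum]
    refine Finset.sum_congr rfl fun j hj => Nat.mul_div_cancel' ?_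
    have := Finset.mem_range.mp hj
    exact hp.dvd_choose_self (by omega) (by omega)
  have hq : p * ((2 ^ (p - 1) - 1) / p) = 2 ^ (p - 1) - 1 := by
    refine Nat.mul_div_cancel' ?_
    rw [← ZMod.natCast_eq_zero_iff, Nat.cast_sub Nat.one_le_two_pow]
    push_cast
    rw [ZMod.pow_card_sub_one_eq_one, sub_self]
    have : ((2 : ℕ) : ZMod p) ≠ 0 := by
      rw [Ne, ZMod.natCast_eq_zero_iff, Nat.prime_dvd_prime_iff_eq hp Nat.prime_two]
      exact hp2
    exact_mod_cast this
  have hnat : ∑ j ∈ Finset.range (p - 1), p.choose (j + 1) / p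
      = 2 * ((2 ^ (p - 1) - 1) / p) := by
    refine Nat.eq_of_mul_eq_mul_left hp.pos ?_
    rw [hdiv, mul_left_comm, hq]
    omega
  have hcast := congrArg (Nat.cast : ℕ → ZMod p) hnat
  rw [Nat.cast_sum, Nat.cast_mul, Nat.cast_ofNat] at hcast
  rw [qF, ← hcast]
  refine Finset.sum_congr rfl fun j hj => (cast_choose_prime_div hp ?_).symm
  have := Finset.mem_range.mp hj
  omega

/-- The alternating harmonic sum of length `(p - 1) / 2` is `q_p` modulo `p`. -/
theorem sum_half_neg_one_pow_mul_inv {m : ℕ} (hp : (2 * m + 1).Prime) :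
    ∑ j ∈ Finset.range m, (-1 : ZMod (2 * m + 1)) ^ j * ((j + 1 : ℕ) : ZMod (2 * m + 1))⁻¹
      = qF (2 * m + 1) := by
  have : Fact (2 * m + 1).Prime := ⟨hp⟩
  have htwo : (2 : ZMod (2 * m + 1)) ≠ 0 := by
    have : ((2 : ℕ) : ZMod (2 * m + 1)) ≠ 0 := by
      rw [Ne, ZMod.natCast_eq_zero_iff, Nat.prime_dvd_prime_iff_eq hp Nat.prime_two]
      omega
    exact_mod_cast this
  refine mul_left_cancel₀ htwo ?_
  rw [← sum_neg_one_pow_mul_inv hp (by omega), Nat.add_sub_cancel,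
    sum_range_two_mul_eq_add_reflect, two_mul (Finset.sum _ _), add_right_inj]
  refine Finset.sum_congr rfl fun j hj => ?_
  have hj := Finset.mem_range.mp hj
  have hcast : ((m + (m - 1 - j) + 1 : ℕ) : ZMod (2 * m + 1))
      = -((j + 1 : ℕ) : ZMod (2 * m + 1)) := by
    rw [eq_neg_iff_add_eq_zero, ← Nat.cast_add,
      show m + (m - 1 - j) + 1 + (j + 1) = 2 * m + 1 by omega, ZMod.natCast_self]
  have hsign : (-1 : ZMod (2 * m + 1)) ^ (m + (m - 1 - j)) = -(-1) ^ j := by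
    rw [← neg_one_mul ((-1 : ZMod (2 * m + 1)) ^ j), ← pow_succ']
    exact neg_one_pow_congr (by grind)
  rw [hcast, hsign, inv_neg, neg_mul_neg]

/-- For every odd prime `p`,
`Σ_{0 < k < p, k odd} (−1)^{(k−1)/2} k⁻¹ = (−1)^{(p−1)/2} q_p/2` in `ℤ/pℤ`;
i.e. the finite alternating value `T_𝒜(1̄) = ((−1)^{(p−1)/2} q_p(2)/2 mod p)_p`. -/
theorem T_bar_one (p : ℕ) (hp : p.Prime) (hp2 : p ≠ 2) :
    ∑ k ∈ (Finset.Ioo 0 p).filter (fun k => k % 2 = 1),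
        (-1 : ZMod p) ^ ((k - 1) / 2) * (k : ZMod p)⁻¹
      = (-1 : ZMod p) ^ ((p - 1) / 2) * qF p * (2 : ZMod p)⁻¹ := by
  obtain ⟨m, rfl⟩ := hp.odd_of_ne_two hp2
  have : Fact (2 * m + 1).Prime := ⟨hp⟩
  rw [← sum_half_neg_one_pow_mul_inv hp, Finset.mul_sum, Finset.sum_mul]
  refine Finset.sum_nbij' (fun k => m - 1 - k / 2) (fun j => 2 * (m - 1 - j) + 1) ?_ ?_ ?_ ?_ ?_
  · simp only [Finset.mem_filter, Finset.mem_Ioo, Finset.mem_range]; omega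
  · simp only [Finset.mem_filter, Finset.mem_Ioo, Finset.mem_range]; omega
  · simp only [Finset.mem_filter, Finset.mem_Ioo]; omega
  · simp only [Finset.mem_range]; omega
  · intro k hk
    simp only [Finset.mem_filter, Finset.mem_Ioo] at hk
    obtain ⟨i, rfl⟩ : ∃ i, k = 2 * i + 1 := ⟨k / 2, by omega⟩
    have hcast : ((2 * i + 1 : ℕ) : ZMod (2 * m + 1))
        = -(((m - 1 - i + 1 : ℕ) : ZMod (2 * m + 1)) * 2) := by
      rw [eq_neg_iff_add_eq_zero, ← Nat.cast_two (R := ZMod (2 * m + 1)), ← Nat.cast_mul,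
        ← Nat.cast_add, show 2 * i + 1 + (m - 1 - i + 1) * 2 = 2 * m + 1 by omega, ZMod.natCast_self]
    have hsign : (-1 : ZMod (2 * m + 1)) ^ i = -((-1) ^ m * (-1) ^ (m - 1 - i)) := by
      rw [← pow_add, ← neg_one_mul ((-1 : ZMod (2 * m + 1)) ^ _), ← pow_succ']
      exact neg_one_pow_congr (by grind)
    rw [show (2 * i + 1 - 1) / 2 = i by omega, show (2 * i + 1) / 2 = i by omega,
      show (2 * m + 1 - 1) / 2 = m by omega, hcast, hsign, inv_neg, mul_inv]
    ring
end

section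
/- For every odd prime p, 2·T_p((1,1); (1,−1)) + T_p((1,1); (−1,−1)) = 0 in ℤ/pℤ; that is, 2·T_𝒜(1,1̄) + T_𝒜(1̄,1̄) = 0 for the finite alternating multiple T-values. -/
open scoped Classical

/-- Pairs `p > n > m > 0` with `n` even and `m` odd. -/
def evenOddPairs (p : ℕ) : Finset (ℕ × ℕ) :=
  {x ∈ Finset.range p ×ˢ Finset.range p | x.2 < x.1 ∧ x.1 % 2 = 0 ∧ x.2 % 2 = 1}

/-- Pairs of odd numbers with sum less than `p`. -/
def oddOddPairs (p : ℕ) : Finset (ℕ × ℕ) :=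
  {x ∈ Finset.range p ×ˢ Finset.range p | x.1 + x.2 < p ∧ x.1 % 2 = 1 ∧ x.2 % 2 = 1}

theorem mem_evenOddPairs {p : ℕ} {x : ℕ × ℕ} :
    x ∈ evenOddPairs p ↔ x.1 < p ∧ x.2 < x.1 ∧ x.1 % 2 = 0 ∧ x.2 % 2 = 1 := by
  simp only [evenOddPairs, Finset.mem_filter, Finset.mem_product, Finset.mem_range]
  omega

theorem mem_oddOddPairs {p : ℕ} {x : ℕ × ℕ} :
    x ∈ oddOddPairs p ↔ x.1 + x.2 < p ∧ x.1 % 2 = 1 ∧ x.2 % 2 = 1 := by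
  simp only [oddOddPairs, Finset.mem_filter, Finset.mem_product, Finset.mem_range]
  omega

theorem TaltP_pair (p : ℕ) (a b : ℤ) :
    TaltP p [(1, a), (1, b)] = ∑ x ∈ evenOddPairs p,
      (a : ZMod p) ^ ((x.1 - 2) / 2) * (x.1 : ZMod p)⁻¹ *
        ((b : ZMod p) ^ ((x.2 - 1) / 2) * (x.2 : ZMod p)⁻¹) := by
  rw [TaltP, ← Finset.sum_filter]
  refine Finset.sum_bij (fun n _ => ((n (0 : Fin 2) : ℕ), (n (1 : Fin 2) : ℕ))) ?_ ?_ ?_ ?_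
  · intro n hn
    obtain ⟨-, -, h₂, h₃⟩ := Finset.mem_filter.1 hn
    have h₄ := h₂ (0 : Fin 2) (1 : Fin 2) (zero_lt_one (α := Fin 2))
    have h₅ := h₃ (0 : Fin 2)
    have h₆ := h₃ (1 : Fin 2)
    simp only [List.length_cons, List.length_nil] at h₅ h₆
    exact mem_evenOddPairs.2 ⟨(n (0 : Fin 2)).2, h₄, h₅, h₆⟩
  · intro n _ n' _ h
    obtain ⟨h₀, h₁⟩ := Prod.mk.inj h
    funext j
    change Fin 2 at j
    fin_cases j
    · exact Fin.ext h₀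
    · exact Fin.ext h₁
  · rintro ⟨n, m⟩ h
    obtain ⟨h₁, h₂, h₃, h₄⟩ := mem_evenOddPairs.1 h
    simp only at h₁ h₂ h₃ h₄
    refine ⟨(![⟨n, h₁⟩, ⟨m, h₂.trans h₁⟩] : Fin 2 → Fin p), Finset.mem_filter.2
      ⟨Finset.mem_univ _, ?_, ?_, ?_⟩, rfl⟩
    · change ∀ j : Fin 2, _
      rw [Fin.forall_fin_two]
      exact ⟨show 0 < n by omega, show 0 < m by omega⟩
    · change ∀ i j : Fin 2, _
      simp only [Fin.forall_fin_two]
      exact ⟨⟨fun h => absurd h (lt_irrefl _), fun _ => h₂⟩,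
        ⟨fun h => absurd h (not_lt_of_gt (zero_lt_one (α := Fin 2))), fun h => absurd h (lt_irrefl _)⟩⟩
    · change ∀ j : Fin 2, _
      rw [Fin.forall_fin_two]
      exact ⟨show n % 2 = 2 % 2 from h₃, show m % 2 = 1 % 2 from h₄⟩
  · intro n _
    refine (Fin.prod_univ_two (M := ZMod p) _).trans ?_
    change (a : ZMod p) ^ (((n (0 : Fin 2) : ℕ) + 0 - 2) / 2) *
        (((n (0 : Fin 2) : ℕ) : ZMod p) ^ 1)⁻¹ *
      ((b : ZMod p) ^ (((n (1 : Fin 2) : ℕ) + 1 - 2) / 2) *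
        (((n (1 : Fin 2) : ℕ) : ZMod p) ^ 1)⁻¹) = _
    rw [pow_one, pow_one, add_zero, Nat.add_sub_add_right _ 1 1]

section

variable {M : Type*} [AddCommMonoid M]

theorem sum_evenOddPairs_reflect {p : ℕ} (hp : p % 2 = 1) (f : ℕ × ℕ → M) :
    ∑ x ∈ evenOddPairs p, f x = ∑ x ∈ oddOddPairs p, f (p - x.1, x.2) := by
  refine Finset.sum_nbij' (fun x => (p - x.1, x.2)) (fun x => (p - x.1, x.2)) ?_ ?_ ?_ ?_ ?_
  · intro x hx
    rw [mem_evenOddPairs] at hx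
    rw [mem_oddOddPairs]
    dsimp only
    omega
  · intro x hx
    rw [mem_oddOddPairs] at hx
    rw [mem_evenOddPairs]
    dsimp only
    omega
  · intro x hx
    rw [mem_evenOddPairs] at hx
    exact Prod.ext (by dsimp only; omega) rfl
  · intro x hx
    rw [mem_oddOddPairs] at hx
    exact Prod.ext (by dsimp only; omega) rfl
  · intro x hx
    rw [mem_evenOddPairs] at hx
    congr 1
    exact Prod.ext (by dsimp only; omega) rfl

theorem sum_oddOddPairs_swap (p : ℕ) (f : ℕ × ℕ → M) :
    ∑ x ∈ oddOddPairs p, f x.swap = ∑ x ∈ oddOddPairs p, f x := by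
  refine Finset.sum_nbij' Prod.swap Prod.swap ?_ ?_ (by simp) (by simp) (by simp)
  all_goals
    intro x hx
    rw [mem_oddOddPairs] at hx ⊢
    simp only [Prod.fst_swap, Prod.snd_swap]
    omega

theorem sum_evenOddPairs_add (p : ℕ) (f : ℕ × ℕ → M) :
    ∑ x ∈ evenOddPairs p, f x = ∑ x ∈ oddOddPairs p, f (x.1 + x.2, x.2) := by
  refine Finset.sum_nbij' (fun x => (x.1 - x.2, x.2)) (fun x => (x.1 + x.2, x.2)) ?_ ?_ ?_ ?_ ?_
  · intro x hx
    rw [mem_evenOddPairs] at hx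
    rw [mem_oddOddPairs]
    dsimp only
    omega
  · intro x hx
    rw [mem_oddOddPairs] at hx
    rw [mem_evenOddPairs]
    dsimp only
    omega
  · intro x hx
    rw [mem_evenOddPairs] at hx
    exact Prod.ext (by dsimp only; omega) rfl
  · intro x hx
    exact Prod.ext (by dsimp only; omega) rfl
  · intro x hx
    rw [mem_evenOddPairs] at hx
    congr 1
    exact Prod.ext (by dsimp only; omega) rfl

end

/-- For every odd prime `p`, `2·T_p(1,1̄) + T_p(1̄,1̄) = 0` in `ℤ/pℤ`;
i.e. `2·T_𝒜(1,1̄) + T_𝒜(1̄,1̄) = 0`. -/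
theorem two_T_one_barone (p : ℕ) (hp : p.Prime) (hp2 : p ≠ 2) :
    2 * TaltP p [(1, 1), (1, -1)] + TaltP p [(1, -1), (1, -1)] = 0 := by
  have : Fact p.Prime := ⟨hp⟩
  have hodd : p % 2 = 1 := hp.eq_two_or_odd.resolve_left hp2
  have hne : ∀ k : ℕ, 0 < k → k < p → (k : ZMod p) ≠ 0 := fun k h₀ h₁ h =>
    absurd (Nat.le_of_dvd h₀ ((ZMod.natCast_eq_zero_iff k p).1 h)) (by omega)
  rw [two_mul, TaltP_pair, TaltP_pair]
  nth_rewrite 1 [sum_evenOddPairs_reflect hodd]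
  rw [sum_evenOddPairs_add, sum_evenOddPairs_add, ← sum_oddOddPairs_swap p
    (fun x => ((-1 : ℤ) : ZMod p) ^ ((x.1 + x.2 - 2) / 2) * ((x.1 + x.2 : ℕ) : ZMod p)⁻¹ *
      (((-1 : ℤ) : ZMod p) ^ ((x.2 - 1) / 2) * (x.2 : ZMod p)⁻¹)),
    ← Finset.sum_add_distrib, ← Finset.sum_add_distrib]
  refine Finset.sum_eq_zero fun x hx => ?_
  obtain ⟨k, m⟩ := x
  obtain ⟨h, hk, hm⟩ := mem_oddOddPairs.1 hx
  simp only at h hk hm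
  have hk₀ := hne k (by omega) (by omega)
  have hm₀ := hne m (by omega) (by omega)
  have hkm₀ := hne (k + m) (by omega) h
  have hsign : (-1 : ZMod p) ^ ((m + k - 2) / 2) * (-1) ^ ((k - 1) / 2) =
      (-1) ^ ((m - 1) / 2) := by
    rw [← pow_add, show (m + k - 2) / 2 + (k - 1) / 2 = (m - 1) / 2 + 2 * ((k - 1) / 2) by omega,
      pow_add, pow_mul]
    simp
  have hsub : ((p - k : ℕ) : ZMod p) = -k := by
    rw [Nat.cast_sub (by omega), CharP.cast_eq_zero, zero_sub]
  simp only [Prod.fst_swap, Prod.snd_swap, hsub, Int.cast_one, Int.cast_neg, one_pow, one_mul]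
  rw [mul_mul_mul_comm, hsign, add_comm m k]
  push_cast at hkm₀ ⊢
  rw [inv_neg]
  field_simp
  ring
end

section
/- For every odd prime p, the linear shuffle relation 2·ζ_p(1,2̄,1̄) + ζ_p(2,1̄,1̄) + 2·ζ_p(2̄,1̄,1) = 0 holds in ℤ/pℤ; explicitly, 2·ζ_p((1,2,1);(1,−1,−1)) + ζ_p((2,1,1);(1,−1,−1)) + 2·ζ_p((2,1,1);(−1,−1,1)) = 0. -/
open scoped Classical

/-- Triples `(a, b, c)` with `p > a > b > c > 0`. -/
def decreasingTriples (p : ℕ) : Finset (ℕ × ℕ × ℕ) :=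
  {t ∈ Finset.range p ×ˢ Finset.range p ×ˢ Finset.range p | 0 < t.2.2 ∧ t.2.2 < t.2.1 ∧ t.2.1 < t.1}

/-- Triples `(m, k, l)` of positive integers with `m + k + l < p`. -/
def boundedTriples (p : ℕ) : Finset (ℕ × ℕ × ℕ) :=
  {t ∈ Finset.range p ×ˢ Finset.range p ×ˢ Finset.range p |
    0 < t.1 ∧ 0 < t.2.1 ∧ 0 < t.2.2 ∧ t.1 + t.2.1 + t.2.2 < p}

theorem mem_decreasingTriples {p : ℕ} {t : ℕ × ℕ × ℕ} :
    t ∈ decreasingTriples p ↔ 0 < t.2.2 ∧ t.2.2 < t.2.1 ∧ t.2.1 < t.1 ∧ t.1 < p := by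
  simp only [decreasingTriples, Finset.mem_filter, Finset.mem_product, Finset.mem_range]
  omega

theorem mem_boundedTriples {p : ℕ} {t : ℕ × ℕ × ℕ} :
    t ∈ boundedTriples p ↔ 0 < t.1 ∧ 0 < t.2.1 ∧ 0 < t.2.2 ∧ t.1 + t.2.1 + t.2.2 < p := by
  simp only [boundedTriples, Finset.mem_filter, Finset.mem_product, Finset.mem_range]
  omega

theorem ZsumP_triple (p : ℕ) (x y z : ℕ × ℤ) :
    ZsumP p [x, y, z] = ∑ t ∈ decreasingTriples p,
      ((x.2 : ZMod p) ^ t.1 * ((t.1 : ZMod p) ^ x.1)⁻¹) *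
      ((y.2 : ZMod p) ^ t.2.1 * ((t.2.1 : ZMod p) ^ y.1)⁻¹) *
      ((z.2 : ZMod p) ^ t.2.2 * ((t.2.2 : ZMod p) ^ z.1)⁻¹) := by
  unfold ZsumP
  rw [← Finset.sum_filter]
  change ∑ n : Fin 3 → Fin p with (∀ j, 0 < (n j : ℕ)) ∧
    (∀ i j : Fin 3, i < j → (n j : ℕ) < (n i : ℕ)), _ = _
  refine Finset.sum_bij' (fun n _ => ((n 0 : ℕ), (n 1 : ℕ), (n 2 : ℕ)))
    (fun t ht => ![⟨t.1, ?_⟩, ⟨t.2.1, ?_⟩, ⟨t.2.2, ?_⟩]) ?_ ?_ ?_ ?_ ?_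
  any_goals (rw [mem_decreasingTriples] at ht; omega)
  · intro n hn
    obtain ⟨hpos, hlt⟩ := (Finset.mem_filter.1 hn).2
    exact mem_decreasingTriples.2
      ⟨hpos 2, hlt 1 2 (by decide), hlt 0 1 (by decide), (n 0).isLt⟩
  · intro t ht
    rw [mem_decreasingTriples] at ht
    simp [Fin.forall_fin_succ]
    omega
  · intro n _
    ext j
    fin_cases j <;> rfl
  · intro t _
    rfl
  · intro n _
    exact Fin.prod_univ_three _

section Reindexing

variable {M : Type*} [AddCommMonoid M] (p : ℕ) (f : ℕ × ℕ × ℕ → M)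

theorem sum_boundedTriples_suffix :
    ∑ t ∈ boundedTriples p, f (t.1 + t.2.1 + t.2.2, t.2.1 + t.2.2, t.2.1) =
      ∑ t ∈ decreasingTriples p, f t := by
  refine Finset.sum_nbij' (fun t => (t.1 + t.2.1 + t.2.2, t.2.1 + t.2.2, t.2.1))
    (fun t => (t.1 - t.2.1, t.2.2, t.2.1 - t.2.2)) ?_ ?_ ?_ ?_ (fun _ _ => rfl) <;>
  · rintro ⟨a, b, c⟩ h
    simp only [mem_boundedTriples, mem_decreasingTriples, Prod.mk.injEq, and_true, true_and] at h ⊢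
    omega

theorem sum_boundedTriples_prefix :
    ∑ t ∈ boundedTriples p, f (t.1 + t.2.1 + t.2.2, t.1 + t.2.1, t.1) =
      ∑ t ∈ decreasingTriples p, f t := by
  refine Finset.sum_nbij' (fun t => (t.1 + t.2.1 + t.2.2, t.1 + t.2.1, t.1))
    (fun t => (t.2.2, t.2.1 - t.2.2, t.1 - t.2.1)) ?_ ?_ ?_ ?_ (fun _ _ => rfl) <;>
  · rintro ⟨a, b, c⟩ h
    simp only [mem_boundedTriples, mem_decreasingTriples, Prod.mk.injEq, and_true, true_and] at h ⊢
    omega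

theorem sum_boundedTriples_reflect :
    ∑ t ∈ boundedTriples p, f (p - t.1, t.2.1 + t.2.2, t.2.1) =
      ∑ t ∈ decreasingTriples p, f t := by
  refine Finset.sum_nbij' (fun t => (p - t.1, t.2.1 + t.2.2, t.2.1))
    (fun t => (p - t.1, t.2.2, t.2.1 - t.2.2)) ?_ ?_ ?_ ?_ (fun _ _ => rfl) <;>
  · rintro ⟨a, b, c⟩ h
    simp only [mem_boundedTriples, mem_decreasingTriples, Prod.mk.injEq, and_true, true_and] at h ⊢
    omega

theorem sum_boundedTriples_swap :
    ∑ t ∈ boundedTriples p, f (t.2.1, t.1, t.2.2) = ∑ t ∈ boundedTriples p, f t := by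
  refine Finset.sum_nbij' (fun t => (t.2.1, t.1, t.2.2)) (fun t => (t.2.1, t.1, t.2.2))
    ?_ ?_ (fun _ _ => rfl) (fun _ _ => rfl) (fun _ _ => rfl) <;>
  · rintro ⟨a, b, c⟩ h
    simp only [mem_boundedTriples] at h ⊢
    omega

end Reindexing

theorem inv_mul_inv_eq_inv_add_mul {K : Type*} [Field K] {x y : K} (hx : x ≠ 0) (hy : y ≠ 0)
    (hxy : x + y ≠ 0) : x⁻¹ * y⁻¹ = (x + y)⁻¹ * (x⁻¹ + y⁻¹) := by
  field_simp
  ring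

/-- The partial fraction identity for the shuffle of a word of weight one with a word of
weight three. -/
theorem shuffle_partial_fractions {K : Type*} [Field K] {m k l : K} (hm : m ≠ 0) (hk : k ≠ 0)
    (hmk : m + k ≠ 0) (hkl : k + l ≠ 0) (hmkl : m + k + l ≠ 0) :
    m⁻¹ * ((k + l) ^ 2)⁻¹ * k⁻¹ =
      (m + k + l)⁻¹ * ((k + l) ^ 2)⁻¹ * k⁻¹ + ((m + k + l) ^ 2)⁻¹ * (k + l)⁻¹ * k⁻¹ +
      ((m + k + l) ^ 2)⁻¹ * (m + k)⁻¹ * (m⁻¹ + k⁻¹) := by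
  have h₁ := inv_mul_inv_eq_inv_add_mul hm hk hmk
  have h₂ := inv_mul_inv_eq_inv_add_mul hm hkl (by rwa [← add_assoc])
  rw [← add_assoc] at h₂
  simp only [← inv_pow]
  linear_combination (k⁻¹ * (k + l)⁻¹ + k⁻¹ * (m + k + l)⁻¹) * h₂ + (m + k + l)⁻¹ ^ 2 * h₁

theorem ZMod.natCast_ne_zero_of_pos_of_lt {p n : ℕ} (hn : 0 < n) (hnp : n < p) :
    (n : ZMod p) ≠ 0 := fun h =>
  Nat.not_le_of_lt hnp (Nat.le_of_dvd hn ((ZMod.natCast_eq_zero_iff n p).1 h))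

/-- Linear shuffle relation: for every odd prime `p`,
`2·ζ_p(1,2̄,1̄) + ζ_p(2,1̄,1̄) + 2·ζ_p(2̄,1̄,1) = 0` in `ℤ/pℤ`. -/
theorem linear_shuffle_b_acb (p : ℕ) (hp : p.Prime) (hp2 : p ≠ 2) :
    2 * ZsumP p [(1, 1), (2, -1), (1, -1)] + ZsumP p [(2, 1), (1, -1), (1, -1)]
      + 2 * ZsumP p [(2, -1), (1, -1), (1, 1)] = 0 := by
  have := Fact.mk hp
  set A := ZsumP p [(1, 1), (2, -1), (1, -1)] with hA
  set B := ZsumP p [(2, 1), (1, -1), (1, -1)] with hB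
  set C := ZsumP p [(2, -1), (1, -1), (1, 1)] with hC
  have sign_add_self (k l : ℕ) : (-1 : ZMod p) ^ (k + l) * (-1) ^ k = (-1) ^ l := by
    rw [pow_add, mul_right_comm, ← mul_pow]; simp
  have hA_suffix : A = ∑ t ∈ boundedTriples p, (-1 : ZMod p) ^ t.2.2 *
      ((t.1 + t.2.1 + t.2.2 : ZMod p)⁻¹ * ((t.2.1 + t.2.2 : ZMod p) ^ 2)⁻¹ *
        (t.2.1 : ZMod p)⁻¹) := by
    rw [hA, ZsumP_triple, ← sum_boundedTriples_suffix]
    refine Finset.sum_congr rfl fun t _ => ?_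
    rw [← sign_add_self t.2.1 t.2.2]
    push_cast
    ring
  have hA_reflect : -A = ∑ t ∈ boundedTriples p, (-1 : ZMod p) ^ t.2.2 *
      ((t.1 : ZMod p)⁻¹ * ((t.2.1 + t.2.2 : ZMod p) ^ 2)⁻¹ * (t.2.1 : ZMod p)⁻¹) := by
    rw [hA, ZsumP_triple, ← sum_boundedTriples_reflect, ← Finset.sum_neg_distrib]
    refine Finset.sum_congr rfl fun t ht => ?_
    rw [mem_boundedTriples] at ht
    rw [← sign_add_self t.2.1 t.2.2]
    push_cast [Nat.cast_sub (show t.1 ≤ p by omega), ZMod.natCast_self, zero_sub, pow_one, inv_neg]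
    ring
  have hB_suffix : B = ∑ t ∈ boundedTriples p, (-1 : ZMod p) ^ t.2.2 *
      (((t.1 + t.2.1 + t.2.2 : ZMod p) ^ 2)⁻¹ * (t.2.1 + t.2.2 : ZMod p)⁻¹ *
        (t.2.1 : ZMod p)⁻¹) := by
    rw [hB, ZsumP_triple, ← sum_boundedTriples_suffix]
    refine Finset.sum_congr rfl fun t _ => ?_
    rw [← sign_add_self t.2.1 t.2.2]
    push_cast
    ring
  have hC_prefix : C = ∑ t ∈ boundedTriples p, (-1 : ZMod p) ^ t.2.2 *
      (((t.1 + t.2.1 + t.2.2 : ZMod p) ^ 2)⁻¹ * (t.1 + t.2.1 : ZMod p)⁻¹ *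
        (t.1 : ZMod p)⁻¹) := by
    rw [hC, ZsumP_triple, ← sum_boundedTriples_prefix]
    refine Finset.sum_congr rfl fun t _ => ?_
    rw [← sign_add_self (t.1 + t.2.1) t.2.2]
    push_cast
    ring
  have hC_swap : C = ∑ t ∈ boundedTriples p, (-1 : ZMod p) ^ t.2.2 *
      (((t.1 + t.2.1 + t.2.2 : ZMod p) ^ 2)⁻¹ * (t.1 + t.2.1 : ZMod p)⁻¹ *
        (t.2.1 : ZMod p)⁻¹) := by
    rw [hC_prefix, ← sum_boundedTriples_swap]
    refine Finset.sum_congr rfl fun t _ => ?_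
    rw [add_comm (t.2.1 : ZMod p)]
  have shuffle : -A = A + B + (C + C) := by
    conv_rhs => enter [2, 2]; rw [hC_swap]
    rw [hA_reflect, hA_suffix, hB_suffix, hC_prefix]
    simp only [← Finset.sum_add_distrib, ← mul_add]
    refine Finset.sum_congr rfl fun t ht => ?_
    rw [mem_boundedTriples] at ht
    have ne_zero {n : ℕ} (hn : 0 < n) (hnp : n < p) : (n : ZMod p) ≠ 0 :=
      ZMod.natCast_ne_zero_of_pos_of_lt hn hnp
    congr 1
    apply shuffle_partial_fractions
    · exact ne_zero (by omega) (by omega)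
    · exact ne_zero (by omega) (by omega)
    · exact_mod_cast ne_zero (n := t.1 + t.2.1) (by omega) (by omega)
    · exact_mod_cast ne_zero (n := t.2.1 + t.2.2) (by omega) (by omega)
    · exact_mod_cast ne_zero (n := t.1 + t.2.1 + t.2.2) (by omega) (by omega)
  linear_combination -shuffle
end
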